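/- Let k ≥ 3 be an integer. For all M, N ∈ ℕ there exists a constant C, depending only on k, M and N, such that for every smooth function G : ℝ → ℂ with support contained in [1/4, 5/4], every real X ≥ 1, all positive integers l, f, every ξ ∈ ℤ, and every nonzero ν ∈ ℤ: | J_{l,f}(ξ, ν, X) | ≤ C · ‖G‖_{M,1} · ( X^{(N−M+3)/2} / (|ν|^M · (lf²)^N) ) · [ (lf²/√X)^M + |ξ|^M ], where ‖G‖_{M,1} = ∑_{j=0}^{M} ∫_ℝ |G^{(j)}(t)| dt. -/

import Mathlib

open MeasureTheory

/-- `e(t) = e^{2πit}`. -/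
noncomputable def e2 (t : ℝ) : ℂ := Complex.exp (2 * Real.pi * Complex.I * t)

/-- The archimedean test function `θ_∞` attached to weight `k`:
`θ_∞(x) = (i/(2π))·((x + i√(1−x²))^{k−1} − (x − i√(1−x²))^{k−1})` for `|x| < 1`,
and `0` otherwise. -/
noncomputable def thetaInf (k : ℕ) (x : ℝ) : ℂ :=
  if |x| < 1 then
    (Complex.I / (2 * (Real.pi : ℂ))) *
      (((x : ℂ) + Complex.I * (Real.sqrt (1 - x ^ 2) : ℝ)) ^ (k - 1) -
        ((x : ℂ) - Complex.I * (Real.sqrt (1 - x ^ 2) : ℝ)) ^ (k - 1))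
  else 0

/-- The cutoff `F(x) = (∫_x^∞ e^{−y−1/y} y^{−1} dy)/(∫_0^∞ e^{−y−1/y} y^{−1} dy)`
from the approximate functional equation. -/
noncomputable def Fcut (x : ℝ) : ℝ :=
  (∫ y in Set.Ioi x, Real.exp (-y - 1/y) / y) /
    (∫ y in Set.Ioi (0 : ℝ), Real.exp (-y - 1/y) / y)

/-- The Mellin transform `F̃(u) = ∫_0^∞ F(x)·x^{u−1} dx`. -/
noncomputable def Ftilde (u : ℂ) : ℂ :=
  ∫ x in Set.Ioi (0 : ℝ), (Fcut x : ℂ) * (x : ℂ) ^ (u - 1)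

/-- `H(y) = (√π/(2π)) ∫_{Re u = 1} (Γ((1+u)/2)/Γ((2−u)/2))·(πy)^{−u}·F̃(u) du`,
written as an integral over `t ∈ ℝ` with `u = 1 + it`. -/
noncomputable def Hfun (y : ℝ) : ℂ :=
  ((Real.sqrt Real.pi / (2 * Real.pi) : ℝ) : ℂ) *
    ∫ t : ℝ,
      (Complex.Gamma ((2 + (t : ℂ) * Complex.I) / 2) /
          Complex.Gamma ((1 - (t : ℂ) * Complex.I) / 2)) *
        ((Real.pi * y : ℝ) : ℂ) ^ (-(1 + (t : ℂ) * Complex.I)) *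
        Ftilde (1 + (t : ℂ) * Complex.I)

/-- The Fourier transform
`J_{l,f}(ξ, ν, X) = ∫_0^∞ ∫_{−1}^{1} √y·G(y/X)·θ_∞(x)·{F(lf²/(2√y√(1−x²))) +
(lf²/(2√y√(1−x²)))·H(lf²/(2√y√(1−x²)))}·e(−(2xξ√y + yν)/(4lf²)) dx dy`. -/
noncomputable def Jlf (k l f : ℕ) (ξ ν : ℤ) (X : ℝ) (G : ℝ → ℂ) : ℂ :=
  ∫ y in Set.Ioi (0 : ℝ), ∫ x in (-1 : ℝ)..1,
    ((Real.sqrt y : ℝ) : ℂ) * G (y / X) * thetaInf k x *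
      (((Fcut ((l * f ^ 2 : ℝ) / (2 * Real.sqrt y * Real.sqrt (1 - x ^ 2))) : ℝ) : ℂ) +
        (((l * f ^ 2 : ℝ) / (2 * Real.sqrt y * Real.sqrt (1 - x ^ 2)) : ℝ) : ℂ) *
          Hfun ((l * f ^ 2 : ℝ) / (2 * Real.sqrt y * Real.sqrt (1 - x ^ 2)))) *
      e2 (-(2 * x * (ξ : ℝ) * Real.sqrt y + y * (ν : ℝ)) / (4 * (l : ℝ) * (f : ℝ) ^ 2))

/-- The Sobolev `W^{M,1}`-norm `‖G‖_{M,1} = ∑_{j=0}^M ∫ |G^{(j)}(t)| dt`. -/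
noncomputable def sobolevNorm (M : ℕ) (G : ℝ → ℂ) : ℝ :=
  ∑ j ∈ Finset.range (M + 1), ∫ t : ℝ, ‖iteratedDeriv j G t‖


namespace JB
open Complex (I)
open Set Filter Topology

noncomputable def wK (y : ℝ) : ℝ := Real.exp (-y - 1/y)

lemma wK_pos (y : ℝ) : 0 < wK y := Real.exp_pos _

lemma wK_le_pow (n : ℕ) {y : ℝ} (hy : 0 < y) :
    wK y ≤ n.factorial * y ^ n ∧ wK y ≤ n.factorial * (y ^ n)⁻¹ := by
  have hf : (0:ℝ) < n.factorial := by exact_mod_cast n.factorial_pos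
  have key : ∀ z : ℝ, 0 < z → Real.exp (-z) ≤ n.factorial * (z ^ n)⁻¹ := by
    intro z hz
    have h := Real.pow_div_factorial_le_exp z hz.le n
    rw [Real.exp_neg]
    have h2 : (n.factorial:ℝ) * (z^n)⁻¹ = (z ^ n / n.factorial)⁻¹ := by
      rw [inv_div]; rfl
    rw [h2]
    exact inv_anti₀ (by positivity) h
  constructor
  · have h := key (1/y) (by positivity)
    have : wK y ≤ Real.exp (-(1/y)) := by
      unfold wK; apply Real.exp_le_exp.mpr; linarith
    refine this.trans (h.trans (le_of_eq ?_))
    simp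
  · have h := key y hy
    have : wK y ≤ Real.exp (-y) := by
      unfold wK; apply Real.exp_le_exp.mpr
      have : 0 < 1/y := by positivity
      linarith
    exact this.trans h

lemma wK_le_rpow (a : ℝ) : ∃ C : ℝ, 0 < C ∧ ∀ y : ℝ, 0 < y → wK y ≤ C * y ^ a := by
  obtain ⟨n, hn⟩ := exists_nat_ge |a|
  have hf : (0:ℝ) < n.factorial := by exact_mod_cast n.factorial_pos
  refine ⟨n.factorial, hf, fun y hy => ?_⟩
  rcases le_total 1 y with h1 | h1
  · refine (wK_le_pow n hy).2.trans ?_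
    gcongr
    rw [← Real.rpow_natCast, ← Real.rpow_neg hy.le]
    exact Real.rpow_le_rpow_of_exponent_le h1 (by linarith [neg_abs_le a])
  · refine (wK_le_pow n hy).1.trans ?_
    gcongr
    rw [← Real.rpow_natCast]
    exact Real.rpow_le_rpow_of_exponent_ge hy h1 (by linarith [le_abs_self a])

lemma wK_contOn : ContinuousOn wK (Ioi 0) := by
  unfold wK
  apply Real.continuous_exp.comp_continuousOn
  apply ContinuousOn.sub (by fun_prop)
  exact continuousOn_const.div continuousOn_id (fun x hx => (ne_of_gt hx))

lemma wKc_contOn : ContinuousOn (fun y => (wK y : ℂ)) (Ioi 0) :=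
  Complex.continuous_ofReal.comp_continuousOn wK_contOn

lemma wKc_top (a : ℝ) : (fun y => (wK y : ℂ)) =O[atTop] fun x : ℝ => x ^ (-a) := by
  obtain ⟨C, hC, h⟩ := wK_le_rpow (-a)
  apply Asymptotics.IsBigO.of_bound C
  filter_upwards [eventually_gt_atTop 0] with y hy
  rw [Complex.norm_real, Real.norm_of_nonneg (wK_pos y).le,
    Real.norm_of_nonneg (Real.rpow_nonneg hy.le _)]
  exact h y hy

lemma wKc_zero (a : ℝ) : (fun y => (wK y : ℂ)) =O[𝓝[>] 0] fun x : ℝ => x ^ (-a) := by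
  obtain ⟨C, hC, h⟩ := wK_le_rpow (-a)
  apply Asymptotics.IsBigO.of_bound C
  filter_upwards [self_mem_nhdsWithin] with y hy
  rw [Complex.norm_real, Real.norm_of_nonneg (wK_pos y).le,
    Real.norm_of_nonneg (Real.rpow_nonneg (le_of_lt hy) _)]
  exact h y hy

noncomputable def Kf (u : ℂ) : ℂ := mellin (fun y => (wK y : ℂ)) u

lemma K_conv (u : ℂ) : MellinConvergent (fun y => (wK y : ℂ)) u :=
  mellinConvergent_of_isBigO_rpow (a := u.re + 1) (b := u.re - 1)
    (wKc_contOn.locallyIntegrableOn measurableSet_Ioi) (wKc_top _) (by linarith)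
    (wKc_zero _) (by linarith)

lemma K_diff : Differentiable ℂ Kf := fun u =>
  mellin_differentiableAt_of_isBigO_rpow (a := u.re + 1) (b := u.re - 1)
    (wKc_contOn.locallyIntegrableOn measurableSet_Ioi) (wKc_top _) (by linarith)
    (wKc_zero _) (by linarith)

/-- real version of integrability -/
lemma wK_int (p : ℝ) : IntegrableOn (fun y => wK y * y ^ (p - 1)) (Ioi 0) := by
  have h := (K_conv (p:ℂ)).norm
  refine (integrableOn_congr_fun ?_ measurableSet_Ioi).mp h
  intro y hy
  simp only [norm_smul, Complex.norm_real, Real.norm_of_nonneg (wK_pos y).le]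
  rw [Complex.norm_cpow_eq_rpow_re_of_pos hy]
  simp [mul_comm]

noncomputable def Kr (p : ℝ) : ℝ := ∫ y in Ioi (0:ℝ), wK y * y ^ (p - 1)

lemma norm_Kf_le (u : ℂ) : ‖Kf u‖ ≤ Kr u.re := by
  unfold Kf mellin Kr
  refine (norm_integral_le_integral_norm _).trans (le_of_eq ?_)
  apply setIntegral_congr_fun measurableSet_Ioi
  intro y hy
  simp only [norm_smul, Complex.norm_real, Real.norm_of_nonneg (wK_pos y).le]
  rw [Complex.norm_cpow_eq_rpow_re_of_pos hy]
  simp [mul_comm]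

lemma Kr_nonneg (p : ℝ) : 0 ≤ Kr p :=
  setIntegral_nonneg measurableSet_Ioi
    (fun y hy => mul_nonneg (wK_pos y).le (Real.rpow_nonneg (le_of_lt hy) _))

lemma Kr_le {p a b : ℝ} (ha : a ≤ p) (hb : p ≤ b) : Kr p ≤ Kr a + Kr b := by
  unfold Kr
  rw [← integral_add (wK_int a) (wK_int b)]
  apply setIntegral_mono_on (wK_int p) ((wK_int a).add (wK_int b)) measurableSet_Ioi
  intro y hy
  have hy : 0 < y := hy
  simp only [Pi.add_apply]
  rw [← mul_add]
  apply mul_le_mul_of_nonneg_left _ (wK_pos y).le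
  have h1 := Real.rpow_nonneg hy.le (a-1)
  have h2 := Real.rpow_nonneg hy.le (b-1)
  rcases le_total 1 y with h | h
  · have := Real.rpow_le_rpow_of_exponent_le h (show p - 1 ≤ b - 1 by linarith)
    linarith
  · have := Real.rpow_le_rpow_of_exponent_ge hy h (show a - 1 ≤ p - 1 by linarith)
    linarith

lemma wK_deriv {y : ℝ} (hy : 0 < y) : HasDerivAt wK (wK y * (-1 + 1 / y ^ 2)) y := by
  have h1 : HasDerivAt (fun y : ℝ => -y - 1 / y) (-1 - (-1 / y ^ 2)) y := by
    have := (hasDerivAt_id y).neg.sub ((hasDerivAt_inv hy.ne'))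
    simp only [one_div]
    refine this.congr_deriv ?_
    ring
  have := h1.exp
  unfold wK
  convert this using 1
  ring

lemma wK_rpow_top (a : ℝ) : Tendsto (fun y => wK y * y ^ a) atTop (𝓝 0) := by
  obtain ⟨C, hC, h⟩ := wK_le_rpow (-a - 1)
  have h0 : Tendsto (fun y : ℝ => C * y⁻¹) atTop (𝓝 0) := by
    simpa using tendsto_inv_atTop_zero.const_mul C
  refine squeeze_zero' ?_ ?_ h0
  · filter_upwards [eventually_gt_atTop 0] with y hy
    exact mul_nonneg (wK_pos y).le (Real.rpow_nonneg hy.le _)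
  · filter_upwards [eventually_gt_atTop 0] with y hy
    calc wK y * y ^ a ≤ (C * y ^ (-a - 1)) * y ^ a := by
          gcongr; exact h y hy
      _ = C * y⁻¹ := by
          rw [mul_assoc, ← Real.rpow_add hy, ← Real.rpow_neg_one]; ring_nf

lemma wK_rpow_zero (a : ℝ) : Tendsto (fun y => wK y * y ^ a) (𝓝[>] 0) (𝓝 0) := by
  obtain ⟨C, hC, h⟩ := wK_le_rpow (-a + 1)
  have h0 : Tendsto (fun y : ℝ => C * y) (𝓝[>] 0) (𝓝 0) := by
    have : Tendsto (fun y : ℝ => C * y) (𝓝 0) (𝓝 (C * 0)) := (continuous_const.mul continuous_id).tendsto 0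
    rw [mul_zero] at this
    exact this.mono_left nhdsWithin_le_nhds
  refine squeeze_zero' ?_ ?_ h0
  · filter_upwards [self_mem_nhdsWithin] with y hy
    exact mul_nonneg (wK_pos y).le (Real.rpow_nonneg (le_of_lt hy) _)
  · filter_upwards [self_mem_nhdsWithin] with y hy
    have hy : 0 < y := hy
    calc wK y * y ^ a ≤ (C * y ^ (-a + 1)) * y ^ a := by
          gcongr; exact h y hy
      _ = C * y := by
          rw [mul_assoc, ← Real.rpow_add hy]; ring_nf; rw [Real.rpow_one]

lemma int_deriv {f f' : ℝ → ℂ} (hd : ∀ y ∈ Ioi (0:ℝ), HasDerivAt f (f' y) y)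
    (hI : IntegrableOn f' (Ioi 0)) (hf0 : f 0 = 0)
    (hz : Tendsto f (𝓝[>] 0) (𝓝 0)) (ht : Tendsto f atTop (𝓝 0)) :
    ∫ y in Ioi (0:ℝ), f' y = 0 := by
  have hc : ContinuousWithinAt f (Ici 0) 0 := by
    rw [← continuousWithinAt_Ioi_iff_Ici]
    unfold ContinuousWithinAt
    rwa [hf0]
  have := integral_Ioi_of_hasDerivAt_of_tendsto hc hd hI ht
  rw [this, hf0, sub_zero]

lemma K_rec (u : ℂ) (hu : u ≠ 0) : u * Kf u = Kf (u + 1) - Kf (u - 1) := by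
  have hd : ∀ y ∈ Ioi (0:ℝ), HasDerivAt (fun y : ℝ => (wK y : ℂ) * (y : ℂ) ^ u)
      (u * ((y : ℂ) ^ (u - 1) • (wK y : ℂ)) - (y : ℂ) ^ (u + 1 - 1) • (wK y : ℂ)
        + (y : ℂ) ^ (u - 1 - 1) • (wK y : ℂ)) y := by
    intro y hy
    have hy : 0 < y := hy
    have hyc : (y : ℂ) ≠ 0 := by exact_mod_cast hy.ne'
    have h1 := (wK_deriv hy).ofReal_comp
    have h2 := hasDerivAt_ofReal_cpow_const' hy.ne' (r := u - 1) (by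
      intro h; apply hu; linear_combination h)
    have h3 : HasDerivAt (fun y : ℝ => (y : ℂ) ^ u) (u * (y : ℂ) ^ (u - 1)) y := by
      have := h2.const_mul u
      simp only [sub_add_cancel] at this
      refine this.congr_of_eventuallyEq (Eventually.of_forall fun z => ?_)
      field_simp
    refine (h1.mul h3).congr_deriv ?_
    simp only [smul_eq_mul]
    rw [show u + 1 - 1 = u by ring, Complex.cpow_sub _ _ hyc, Complex.cpow_sub _ _ hyc,
      Complex.cpow_sub _ _ hyc]
    push_cast
    simp only [Complex.cpow_one]
    field_simp
    ring
  have hI : IntegrableOn (fun y : ℝ => u * ((y : ℂ) ^ (u - 1) • (wK y : ℂ))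
      - (y : ℂ) ^ (u + 1 - 1) • (wK y : ℂ) + (y : ℂ) ^ (u - 1 - 1) • (wK y : ℂ)) (Ioi 0) :=
    (((K_conv u).const_mul u).sub (K_conv (u+1))).add (K_conv (u-1))
  have hnorm : ∀ y : ℝ, 0 < y → ‖(wK y : ℂ) * (y : ℂ) ^ u‖ = wK y * y ^ u.re := by
    intro y hy
    rw [norm_mul, Complex.norm_real, Real.norm_of_nonneg (wK_pos y).le,
      Complex.norm_cpow_eq_rpow_re_of_pos hy]
  have ht : Tendsto (fun y : ℝ => (wK y : ℂ) * (y : ℂ) ^ u) atTop (𝓝 0) := by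
    rw [tendsto_zero_iff_norm_tendsto_zero]
    refine (wK_rpow_top u.re).congr' ?_
    filter_upwards [eventually_gt_atTop 0] with y hy
    exact (hnorm y hy).symm
  have hz : Tendsto (fun y : ℝ => (wK y : ℂ) * (y : ℂ) ^ u) (𝓝[>] 0) (𝓝 0) := by
    rw [tendsto_zero_iff_norm_tendsto_zero]
    refine (wK_rpow_zero u.re).congr' ?_
    filter_upwards [self_mem_nhdsWithin] with y hy
    exact (hnorm y hy).symm
  have := int_deriv hd hI (by simp [hu]) hz ht
  have i1 : IntegrableOn (fun y : ℝ => u * ((y : ℂ) ^ (u - 1) • (wK y : ℂ))) (Ioi 0) :=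
    (K_conv u).const_mul u
  have i2 : IntegrableOn (fun y : ℝ => (y : ℂ) ^ (u + 1 - 1) • (wK y : ℂ)) (Ioi 0) := K_conv (u+1)
  have i3 : IntegrableOn (fun y : ℝ => (y : ℂ) ^ (u - 1 - 1) • (wK y : ℂ)) (Ioi 0) := K_conv (u-1)
  have i4 : IntegrableOn (fun y : ℝ => u * ((y : ℂ) ^ (u - 1) • (wK y : ℂ))
      - (y : ℂ) ^ (u + 1 - 1) • (wK y : ℂ)) (Ioi 0) := i1.sub i2
  rw [integral_add i4 i3, integral_sub i1 i2, integral_const_mul] at this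
  unfold Kf mellin
  linear_combination this

lemma K_bound (n : ℕ) : ∀ a b : ℝ, ∃ C : ℝ, ∀ u : ℂ, a ≤ u.re → u.re ≤ b →
    |u.im| ^ n * ‖Kf u‖ ≤ C := by
  induction n with
  | zero =>
    intro a b
    refine ⟨Kr a + Kr b, fun u h1 h2 => ?_⟩
    simpa using (norm_Kf_le u).trans (Kr_le h1 h2)
  | succ n ih =>
    intro a b
    obtain ⟨C, hC⟩ := ih (a - 1) (b + 1)
    refine ⟨C + C, fun u h1 h2 => ?_⟩
    by_cases hu : u = 0
    · subst hu
      have := hC 0 (by linarith) (by linarith)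
      have : 0 ≤ C := le_trans (by positivity) this
      simp; linarith
    have e1 := hC (u + 1) (by simp; linarith) (by simp; linarith)
    have e2 := hC (u - 1) (by simp; linarith) (by simp; linarith)
    simp only [Complex.add_im, Complex.sub_im, Complex.one_im, add_zero, sub_zero] at e1 e2
    calc |u.im| ^ (n + 1) * ‖Kf u‖ ≤ |u.im| ^ n * (‖u‖ * ‖Kf u‖) := by
          rw [pow_succ, mul_assoc]
          gcongr
          exact Complex.abs_im_le_norm u
      _ = |u.im| ^ n * ‖Kf (u + 1) - Kf (u - 1)‖ := by rw [← norm_mul, K_rec u hu]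
      _ ≤ |u.im| ^ n * (‖Kf (u + 1)‖ + ‖Kf (u - 1)‖) := by
          gcongr; exact norm_sub_le _ _
      _ ≤ C + C := by rw [mul_add]; exact add_le_add e1 e2

noncomputable def vK (y : ℝ) : ℝ := Real.exp (-y - 1/y) / y

lemma vK_eq {y : ℝ} (hy : 0 < y) : vK y = wK y * y ^ ((0:ℝ) - 1) := by
  unfold vK wK
  rw [zero_sub, Real.rpow_neg_one]; rfl

lemma vK_int : IntegrableOn vK (Ioi 0) :=
  (integrableOn_congr_fun (fun _ hy => (vK_eq hy).symm) measurableSet_Ioi).mp (wK_int 0)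

noncomputable def DK : ℝ := ∫ y in Ioi (0:ℝ), vK y

lemma vK_pos {y : ℝ} (hy : 0 < y) : 0 < vK y := div_pos (Real.exp_pos _) hy

lemma DK_pos : 0 < DK := by
  unfold DK
  rw [setIntegral_pos_iff_support_of_nonneg_ae]
  · have : Function.support vK ∩ Ioi 0 = Ioi 0 := by
      apply inter_eq_right.mpr
      intro y hy
      exact (vK_pos hy).ne'
    rw [this]; simp
  · filter_upwards [ae_restrict_mem measurableSet_Ioi] with y hy
    exact (vK_pos hy).le
  · exact vK_int

lemma Fcut_eq (x : ℝ) : Fcut x = (∫ y in Ioi x, vK y) / DK := rfl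

lemma Fcut_nonneg {x : ℝ} (hx : 0 < x) : 0 ≤ Fcut x := by
  rw [Fcut_eq]
  refine div_nonneg (setIntegral_nonneg measurableSet_Ioi fun y hy => ?_) DK_pos.le
  exact (vK_pos (hx.trans hy)).le

/-- Markov -/
lemma Fcut_le (p : ℝ) (hp : 0 ≤ p) {x : ℝ} (hx : 0 < x) : Fcut x ≤ Kr p / DK * x ^ (-p) := by
  rw [Fcut_eq, div_mul_eq_mul_div]
  apply div_le_div_of_nonneg_right _ DK_pos.le
  have hsub : Ioi x ⊆ Ioi 0 := Ioi_subset_Ioi hx.le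
  calc ∫ y in Ioi x, vK y ≤ ∫ y in Ioi x, (wK y * y ^ (p - 1)) * x ^ (-p) := by
        apply setIntegral_mono_on (vK_int.mono_set hsub) (((wK_int p).mono_set hsub).mul_const _)
          measurableSet_Ioi
        intro y hy
        have hy' : x < y := hy
        have hy0 : 0 < y := hx.trans hy
        rw [vK_eq hy0, mul_assoc]
        apply mul_le_mul_of_nonneg_left _ (wK_pos y).le
        rw [zero_sub, Real.rpow_sub hy0, Real.rpow_neg_one, Real.rpow_one, Real.rpow_neg hx.le]
        have : x ^ p ≤ y ^ p := Real.rpow_le_rpow hx.le hy'.le hp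
        have hxp : 0 < x ^ p := Real.rpow_pos_of_pos hx p
        rw [div_mul_eq_mul_div, inv_eq_one_div]
        apply div_le_div_of_nonneg_right _ hy0.le
        rw [← div_eq_mul_inv, le_div_iff₀ hxp]
        linarith
    _ = (∫ y in Ioi x, (wK y * y ^ (p - 1))) * x ^ (-p) := integral_mul_const _ _
    _ ≤ Kr p * x ^ (-p) := by
        apply mul_le_mul_of_nonneg_right _ (Real.rpow_nonneg hx.le _)
        apply setIntegral_mono_set (wK_int p) _ hsub.eventuallyLE
        filter_upwards [ae_restrict_mem measurableSet_Ioi] with y hy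
        exact mul_nonneg (wK_pos y).le (Real.rpow_nonneg (le_of_lt hy) _)

lemma vK_contOn : ContinuousOn vK (Ioi 0) :=
  wK_contOn.div continuousOn_id (fun x hx => (ne_of_gt hx))

lemma Fcut_deriv {x : ℝ} (hx : 0 < x) : HasDerivAt Fcut (-vK x / DK) x := by
  have hev : ∀ᶠ z in 𝓝 x, Fcut z = (DK - ∫ y in (0:ℝ)..z, vK y) / DK := by
    filter_upwards [lt_mem_nhds hx] with z hz
    rw [Fcut_eq]
    congr 1
    rw [intervalIntegral.integral_of_le hz.le]
    have h := setIntegral_union (μ := volume) (f := vK) (s := Ioc 0 z) (t := Ioi z)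
      (Set.disjoint_left.mpr fun y h1 h2 => absurd h1.2 (not_le.mpr h2)) measurableSet_Ioi
      (vK_int.mono_set Ioc_subset_Ioi_self) (vK_int.mono_set (Ioi_subset_Ioi hz.le))
    rw [Ioc_union_Ioi_eq_Ioi hz.le] at h
    unfold DK
    linarith
  have hc : ContinuousAt vK x := vK_contOn.continuousAt (Ioi_mem_nhds hx)
  have hi : IntervalIntegrable vK volume 0 x := by
    rw [intervalIntegrable_iff_integrableOn_Ioc_of_le hx.le]
    exact vK_int.mono_set Ioc_subset_Ioi_self
  have hm : StronglyMeasurableAtFilter vK (𝓝 x) :=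
    vK_contOn.stronglyMeasurableAtFilter isOpen_Ioi x hx
  have h := intervalIntegral.integral_hasDerivAt_right hi hm hc
  have h2 := (h.const_sub DK).div_const DK
  exact h2.congr_of_eventuallyEq hev

lemma Fcut_contOn : ContinuousOn Fcut (Ioi 0) := fun _ hx =>
  (Fcut_deriv hx).continuousAt.continuousWithinAt

lemma Fc_top (a : ℝ) (ha : 0 ≤ a) : (fun y => (Fcut y : ℂ)) =O[atTop] fun x : ℝ => x ^ (-a) := by
  apply Asymptotics.IsBigO.of_bound (Kr a / DK)
  filter_upwards [eventually_gt_atTop 0] with y hy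
  rw [Complex.norm_real, Real.norm_of_nonneg (Fcut_nonneg hy),
    Real.norm_of_nonneg (Real.rpow_nonneg hy.le _)]
  exact Fcut_le a ha hy

lemma Fc_zero : (fun y => (Fcut y : ℂ)) =O[𝓝[>] 0] fun x : ℝ => x ^ (-(0:ℝ)) := by
  apply Asymptotics.IsBigO.of_bound (Kr 0 / DK)
  filter_upwards [self_mem_nhdsWithin] with y hy
  rw [Complex.norm_real, Real.norm_of_nonneg (Fcut_nonneg hy),
    Real.norm_of_nonneg (Real.rpow_nonneg (le_of_lt hy) _)]
  exact Fcut_le 0 le_rfl hy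

lemma F_conv (u : ℂ) (hu : 0 < u.re) : MellinConvergent (fun y => (Fcut y : ℂ)) u :=
  mellinConvergent_of_isBigO_rpow (a := u.re + 1) (b := 0)
    ((Complex.continuous_ofReal.comp_continuousOn Fcut_contOn).locallyIntegrableOn measurableSet_Ioi)
    (Fc_top _ (by linarith)) (by linarith)
    Fc_zero hu

lemma Ftilde_eq (u : ℂ) (hu : 0 < u.re) : Ftilde u = Kf u / (u * DK) := by
  have hu0 : u ≠ 0 := by rintro rfl; simp at hu
  have hD : (DK : ℂ) ≠ 0 := by exact_mod_cast DK_pos.ne'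
  have hd : ∀ y ∈ Ioi (0:ℝ), HasDerivAt (fun y : ℝ => (Fcut y : ℂ) * (y : ℂ) ^ u)
      (u * ((y : ℂ) ^ (u - 1) • (Fcut y : ℂ)) - (DK : ℂ)⁻¹ * ((y : ℂ) ^ (u - 1) • (wK y : ℂ))) y := by
    intro y hy
    have hy : 0 < y := hy
    have hyc : (y : ℂ) ≠ 0 := by exact_mod_cast hy.ne'
    have h1 := (Fcut_deriv hy).ofReal_comp
    have h2 := hasDerivAt_ofReal_cpow_const' hy.ne' (r := u - 1) (by
      intro h; apply hu0; linear_combination h)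
    have h3 : HasDerivAt (fun y : ℝ => (y : ℂ) ^ u) (u * (y : ℂ) ^ (u - 1)) y := by
      have := h2.const_mul u
      simp only [sub_add_cancel] at this
      refine this.congr_of_eventuallyEq (Eventually.of_forall fun z => ?_)
      field_simp
    refine (h1.mul h3).congr_deriv ?_
    simp only [smul_eq_mul]
    have : vK y = wK y / y := rfl
    rw [Complex.cpow_sub _ _ hyc, this]
    push_cast
    simp only [Complex.cpow_one]
    field_simp
    ring
  have i1 : IntegrableOn (fun y : ℝ => u * ((y : ℂ) ^ (u - 1) • (Fcut y : ℂ))) (Ioi 0) :=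
    (F_conv u hu).const_mul u
  have i2 : IntegrableOn (fun y : ℝ => (DK : ℂ)⁻¹ * ((y : ℂ) ^ (u - 1) • (wK y : ℂ))) (Ioi 0) :=
    (K_conv u).const_mul _
  have hnorm : ∀ y : ℝ, 0 < y → ‖(Fcut y : ℂ) * (y : ℂ) ^ u‖ = Fcut y * y ^ u.re := by
    intro y hy
    rw [norm_mul, Complex.norm_real, Real.norm_of_nonneg (Fcut_nonneg hy),
      Complex.norm_cpow_eq_rpow_re_of_pos hy]
  have ht : Tendsto (fun y : ℝ => (Fcut y : ℂ) * (y : ℂ) ^ u) atTop (𝓝 0) := by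
    have h0 : Tendsto (fun y : ℝ => Kr (u.re + 1) / DK * y⁻¹) atTop (𝓝 0) := by
      simpa using tendsto_inv_atTop_zero.const_mul (Kr (u.re + 1) / DK)
    refine squeeze_zero_norm' ?_ h0
    filter_upwards [eventually_gt_atTop 0] with y hy
    rw [hnorm y hy]
    calc Fcut y * y ^ u.re ≤ (Kr (u.re + 1) / DK * y ^ (-(u.re + 1))) * y ^ u.re := by
          gcongr; exact Fcut_le _ (by linarith) hy
      _ = _ := by
          rw [mul_assoc, ← Real.rpow_add hy, ← Real.rpow_neg_one]; ring_nf
  have hz : Tendsto (fun y : ℝ => (Fcut y : ℂ) * (y : ℂ) ^ u) (𝓝[>] 0) (𝓝 0) := by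
    have h0 : Tendsto (fun y : ℝ => Kr 0 / DK * y ^ u.re) (𝓝[>] 0) (𝓝 0) := by
      have h1 : Tendsto (fun y : ℝ => y ^ u.re) (𝓝 0) (𝓝 0) := by
        have := (Real.continuousAt_rpow_const 0 u.re (Or.inr hu.le)).tendsto
        rwa [Real.zero_rpow hu.ne'] at this
      simpa using (h1.mono_left nhdsWithin_le_nhds).const_mul (Kr 0 / DK)
    refine squeeze_zero_norm' ?_ h0
    filter_upwards [self_mem_nhdsWithin] with y hy
    have hy : 0 < y := hy
    rw [hnorm y hy]
    have := Fcut_le 0 le_rfl hy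
    simp only [neg_zero, Real.rpow_zero, mul_one] at this
    gcongr
  have := int_deriv hd (i1.sub i2) (by simp [hu0]) hz ht
  rw [integral_sub i1 i2, integral_const_mul, integral_const_mul] at this
  have hF : Ftilde u = ∫ y in Ioi (0:ℝ), (y : ℂ) ^ (u - 1) • (Fcut y : ℂ) := by
    unfold Ftilde
    simp only [smul_eq_mul, mul_comm]
  rw [← hF] at this
  unfold Kf mellin
  rw [eq_div_iff (mul_ne_zero hu0 hD)]
  have h2 := congrArg (fun z => z * (DK:ℂ)) this
  simp only [zero_mul, sub_mul] at h2
  rw [mul_comm (DK : ℂ)⁻¹, inv_mul_cancel_right₀ hD] at h2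
  linear_combination h2

lemma norm_beta_le (u : ℂ) (v : ℝ) :
    ‖Complex.betaIntegral u v‖ ≤ ‖Complex.betaIntegral u.re v‖ := by
  have h1 : ∀ w : ℂ, ∀ x ∈ Ioo (0:ℝ) 1, ‖(x : ℂ) ^ (w - 1) * (1 - (x : ℂ)) ^ ((v : ℂ) - 1)‖ =
      x ^ (w.re - 1) * (1 - x) ^ (v - 1) := by
    intro w x hx
    have h : (1 - (x : ℂ)) = ((1 - x : ℝ) : ℂ) := by push_cast; rfl
    rw [norm_mul, h, Complex.norm_cpow_eq_rpow_re_of_pos hx.1,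
      Complex.norm_cpow_eq_rpow_re_of_pos (by linarith [hx.2])]
    simp
  have h2 : Complex.betaIntegral u.re v =
      ((∫ x in (0:ℝ)..1, x ^ (u.re - 1) * (1 - x) ^ (v - 1) : ℝ) : ℂ) := by
    unfold Complex.betaIntegral
    rw [← intervalIntegral.integral_ofReal, intervalIntegral.integral_of_le zero_le_one,
      intervalIntegral.integral_of_le zero_le_one, integral_Ioc_eq_integral_Ioo,
      integral_Ioc_eq_integral_Ioo]
    apply setIntegral_congr_fun measurableSet_Ioo
    intro x hx
    have h : (1 - (x : ℂ)) = ((1 - x : ℝ) : ℂ) := by push_cast; rfl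
    simp only [h]
    rw [Complex.ofReal_mul, Complex.ofReal_cpow hx.1.le, Complex.ofReal_cpow (by linarith [hx.2])]
    push_cast
    rfl
  rw [h2, Complex.norm_real]
  refine le_trans ?_ (le_abs_self _)
  unfold Complex.betaIntegral
  refine (intervalIntegral.norm_integral_le_integral_norm zero_le_one).trans (le_of_eq ?_)
  rw [intervalIntegral.integral_of_le zero_le_one,
      intervalIntegral.integral_of_le zero_le_one, integral_Ioc_eq_integral_Ioo,
      integral_Ioc_eq_integral_Ioo]
  apply setIntegral_congr_fun measurableSet_Ioo
  intro x hx
  exact h1 u x hx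

lemma gamma_le (u : ℂ) (hu : 0 < u.re) (v : ℝ) (hv : 0 < v) :
    ‖Complex.Gamma u‖ * Real.Gamma (u.re + v) ≤ Real.Gamma u.re * ‖Complex.Gamma (u + v)‖ := by
  have hb := norm_beta_le u v
  have e1 := Complex.Gamma_mul_Gamma_eq_betaIntegral (s := u) (t := v) hu (by simpa using hv)
  have e2 := Complex.Gamma_mul_Gamma_eq_betaIntegral (s := u.re) (t := v) (by simpa using hu)
    (by simpa using hv)
  have n1 := congrArg norm e1
  have n2 := congrArg norm e2
  have hg : ∀ x : ℝ, 0 < x → ‖Complex.Gamma (x : ℂ)‖ = Real.Gamma x := by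
    intro x hx
    rw [Complex.Gamma_ofReal, Complex.norm_real, Real.norm_of_nonneg (Real.Gamma_pos_of_pos hx).le]
  rw [← Complex.ofReal_add] at n2
  simp only [norm_mul, hg v hv, hg u.re hu, hg (u.re + v) (by linarith)] at n1 n2
  have hGv := Real.Gamma_pos_of_pos hv
  have hGs := Real.Gamma_pos_of_pos (show 0 < u.re + v by linarith)
  have : Real.Gamma v * (‖Complex.Gamma u‖ * Real.Gamma (u.re + v)) ≤
      Real.Gamma v * (Real.Gamma u.re * ‖Complex.Gamma (u + v)‖) := by
    calc _ = (‖Complex.Gamma u‖ * Real.Gamma v) * Real.Gamma (u.re + v) := by ring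
      _ = ‖Complex.Gamma (u + v)‖ * ‖Complex.betaIntegral u v‖ * Real.Gamma (u.re + v) := by rw [n1]
      _ ≤ ‖Complex.Gamma (u + v)‖ * ‖Complex.betaIntegral u.re v‖ * Real.Gamma (u.re + v) := by
          gcongr
      _ = ‖Complex.Gamma (u + v)‖ * (Real.Gamma (u.re + v) * ‖Complex.betaIntegral u.re v‖) := by ring
      _ = _ := by rw [← n2]; ring
  exact le_of_mul_le_mul_left this hGv

lemma gamma_half (t : ℝ) : ‖Complex.Gamma (1/2 + t * I)‖ ^ 2 * Real.cosh (Real.pi * t) = Real.pi := by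
  have h := Complex.Gamma_mul_Gamma_one_sub (1/2 + t * I)
  have hc : (1 - (1/2 + (t:ℂ) * I)) = (starRingEnd ℂ) (1/2 + t * I) := by
    simp only [map_add, map_mul, Complex.conj_ofReal, Complex.conj_I, map_div₀, map_one, map_ofNat]
    ring
  rw [hc, Complex.Gamma_conj, Complex.mul_conj, Complex.normSq_eq_norm_sq] at h
  have hs : Complex.sin (Real.pi * (1/2 + t * I)) = Real.cosh (Real.pi * t) := by
    rw [show (Real.pi : ℂ) * (1/2 + t * I) = ((Real.pi : ℂ) * t) * I + Real.pi / 2 by ring,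
      Complex.sin_add_pi_div_two, Complex.cos_mul_I]
    push_cast; rfl
  rw [hs] at h
  have hp := Real.cosh_pos (Real.pi * t)
  have : ‖Complex.Gamma (1/2 + t * I)‖ ^ 2 = Real.pi / Real.cosh (Real.pi * t) := by
    exact_mod_cast h
  rw [this]; field_simp

lemma norm_sin_le (z : ℂ) : ‖Complex.sin z‖ ≤ Real.cosh z.im := by
  rw [Complex.sin, Real.cosh_eq]
  rw [norm_div, norm_mul, Complex.norm_I, mul_one]
  simp only [Complex.norm_ofNat]
  apply div_le_div_of_nonneg_right _ (by norm_num)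
  refine (norm_sub_le _ _).trans ?_
  rw [Complex.norm_exp, Complex.norm_exp]
  simp

lemma gamma_half_sin (u : ℂ) : ‖Complex.Gamma (1/2 + u.im * I)‖ * ‖Complex.sin (Real.pi * u / 2)‖
    ≤ 2 := by
  have h1 := gamma_half u.im
  have h2 := norm_sin_le (Real.pi * u / 2)
  have him : ((Real.pi : ℂ) * u / 2).im = Real.pi * u.im / 2 := by
    rw [show (Real.pi : ℂ) * u / 2 = ((Real.pi / 2 : ℝ) : ℂ) * u by push_cast; ring]
    rw [Complex.im_ofReal_mul]; ring
  rw [him] at h2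
  have h3 : Real.cosh (Real.pi * u.im / 2) ^ 2 ≤ Real.cosh (Real.pi * u.im) := by
    have e := Real.cosh_sq (Real.pi * u.im / 2)
    have e2 := Real.cosh_two_mul (Real.pi * u.im / 2)
    rw [show 2 * (Real.pi * u.im / 2) = Real.pi * u.im by ring] at e2
    nlinarith [sq_nonneg (Real.sinh (Real.pi * u.im / 2))]
  refine (mul_le_mul_of_nonneg_left h2 (norm_nonneg _)).trans ?_
  apply abs_le_of_sq_le_sq' _ (by norm_num) |>.2
  rw [mul_pow]
  have : ‖Complex.Gamma (1/2 + u.im * I)‖ ^ 2 * Real.cosh (Real.pi * u.im / 2) ^ 2 ≤ Real.pi := by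
    refine le_trans ?_ h1.le
    gcongr
  linarith [Real.pi_le_four]

lemma gamma_shift (u : ℂ) (hu : 1 ≤ ‖u‖) (n : ℕ) : ‖Complex.Gamma (1/2 + u.im * I + n)‖ ≤
    (n + 1).factorial * ‖u‖ ^ n * ‖Complex.Gamma (1/2 + u.im * I)‖ := by
  induction n with
  | zero => simp
  | succ n ih =>
    have hne : (1/2 + u.im * I + n : ℂ) ≠ 0 := by
      intro h
      have := congrArg Complex.re h
      simp at this
      have h0 : (0:ℝ) ≤ n := Nat.cast_nonneg n
      linarith
    have h := Complex.Gamma_add_one _ hne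
    push_cast
    rw [← add_assoc, h, norm_mul]
    have hn : ‖(1/2 + u.im * I + n : ℂ)‖ ≤ (n + 2) * ‖u‖ := by
      calc ‖(1/2 + u.im * I + n : ℂ)‖ ≤ ‖(1/2 : ℂ)‖ + ‖(u.im * I : ℂ)‖ + ‖(n : ℂ)‖ := norm_add₃_le
        _ = 1/2 + |u.im| + n := by simp
        _ ≤ 1 * ‖u‖ + ‖u‖ + n * ‖u‖ := by
            have := Complex.abs_im_le_norm u
            have h0 : (0:ℝ) ≤ n := Nat.cast_nonneg n
            nlinarith
        _ = _ := by ring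
    calc _ ≤ ((n + 2) * ‖u‖) * ((n + 1).factorial * ‖u‖ ^ n * ‖Complex.Gamma (1/2 + u.im * I)‖) := by
          gcongr
      _ = _ := by
          rw [Nat.factorial_succ (n+1)]; push_cast; ring

lemma gamma_sin_bound (b : ℝ) : ∃ C : ℝ, ∃ m : ℕ, ∀ u : ℂ, 1 ≤ u.re → u.re ≤ b →
    ‖Complex.Gamma u * Complex.sin (Real.pi * u / 2)‖ ≤ C * ‖u‖ ^ m := by
  obtain ⟨m, hm⟩ := exists_nat_gt b
  have hcont : ContinuousOn Real.Gamma (Icc 1 b) := fun x hx =>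
    (Real.differentiableAt_Gamma (fun k => by
      have := hx.1
      have h0 : (0:ℝ) ≤ k := Nat.cast_nonneg k
      intro h; linarith)).continuousAt.continuousWithinAt
  obtain ⟨B, hB⟩ := isCompact_Icc.exists_bound_of_continuousOn hcont
  refine ⟨B * ((m + 1).factorial * 2) / Real.Gamma (m + 1/2), m, fun u h1 h2 => ?_⟩
  have hu1 : 1 ≤ ‖u‖ := h1.trans (Complex.re_le_norm u)
  have hv : 0 < (m + 1/2 : ℝ) - u.re := by linarith
  have h := gamma_le u (by linarith) _ hv
  have e1 : u.re + ((m + 1/2 : ℝ) - u.re) = m + 1/2 := by ring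
  have e2 : u + (((m + 1/2 : ℝ) - u.re : ℝ) : ℂ) = 1/2 + u.im * I + m := by
    push_cast
    linear_combination -(Complex.re_add_im u)
  rw [e1, e2] at h
  have hG : 0 < Real.Gamma (m + 1/2) := Real.Gamma_pos_of_pos (by positivity)
  have hB1 := hB u.re ⟨h1, h2⟩
  have hGu := Real.Gamma_pos_of_pos (show 0 < u.re by linarith)
  rw [Real.norm_of_nonneg hGu.le] at hB1
  have hs := gamma_shift u hu1 m
  have hh := gamma_half_sin u
  rw [norm_mul, div_mul_eq_mul_div, le_div_iff₀ hG]
  calc _ = (‖Complex.Gamma u‖ * Real.Gamma (m + 1/2)) * ‖Complex.sin (Real.pi * u / 2)‖ := by ring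
    _ ≤ (Real.Gamma u.re * ‖Complex.Gamma (1/2 + u.im * I + m)‖) * ‖Complex.sin (Real.pi * u / 2)‖ := by
        gcongr
    _ ≤ (B * ((m + 1).factorial * ‖u‖ ^ m * ‖Complex.Gamma (1/2 + u.im * I)‖)) *
          ‖Complex.sin (Real.pi * u / 2)‖ := by gcongr; exact hGu.le.trans hB1
    _ = B * ((m + 1).factorial * ‖u‖ ^ m) * (‖Complex.Gamma (1/2 + u.im * I)‖ *
          ‖Complex.sin (Real.pi * u / 2)‖) := by ring
    _ ≤ B * ((m + 1).factorial * ‖u‖ ^ m) * 2 := by gcongr; exact mul_nonneg (hGu.le.trans hB1) (by positivity)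
    _ = _ := by ring

lemma gamma_ratio (u : ℂ) (hu : u.re = 1) :
    Complex.Gamma ((1 + u) / 2) / Complex.Gamma ((2 - u) / 2) =
      (Real.sqrt Real.pi : ℂ) / Real.pi * 2 ^ (1 - u) * (Complex.Gamma u * Complex.sin (Real.pi * u / 2)) := by
  have h1 := Complex.Gamma_mul_Gamma_add_half (u / 2)
  have h2 := Complex.Gamma_mul_Gamma_one_sub (u / 2)
  rw [show u / 2 + 1 / 2 = (1 + u) / 2 by ring, show 2 * (u / 2) = u by ring] at h1
  rw [show 1 - u / 2 = (2 - u) / 2 by ring, show (Real.pi : ℂ) * (u / 2) = Real.pi * u / 2 by ring] at h2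
  have hA : Complex.Gamma ((2 - u) / 2) ≠ 0 := Complex.Gamma_ne_zero_of_re_pos (by simp [hu])
  have hB : Complex.Gamma (u / 2) ≠ 0 := Complex.Gamma_ne_zero_of_re_pos (by simp [hu])
  have hpi : (Real.pi : ℂ) ≠ 0 := by exact_mod_cast Real.pi_ne_zero
  have hs : Complex.sin (Real.pi * u / 2) ≠ 0 := by
    intro h
    rw [h, div_zero] at h2
    exact (mul_ne_zero hB hA) h2
  rw [div_eq_iff hA]
  rw [eq_div_iff hs] at h2
  apply mul_left_cancel₀ hB
  rw [h1]
  calc _ = (Real.sqrt Real.pi : ℂ) / Real.pi * 2 ^ (1 - u) * Complex.Gamma u * Real.pi := by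
        field_simp
    _ = _ := by
        linear_combination (-((Real.sqrt Real.pi : ℂ) / Real.pi * 2 ^ (1 - u) * Complex.Gamma u)) * h2

structure Rap (A : ℂ → ℂ) : Prop where
  diff : ∀ u : ℂ, 0 < u.re → DifferentiableAt ℂ A u
  bd : ∀ (n : ℕ) (b : ℝ), ∃ C : ℝ, ∀ u : ℂ, 1 ≤ u.re → u.re ≤ b → ‖u‖ ^ n * ‖A u‖ ≤ C

lemma Rap.mul_lin {A : ℂ → ℂ} (h : Rap A) : Rap (fun u => (1 - u) * A u) := by
  refine ⟨fun u hu => ?_, fun n b => ?_⟩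
  · exact ((differentiableAt_const _).sub differentiableAt_id).mul (h.diff u hu)
  · obtain ⟨C, hC⟩ := h.bd (n+1) b
    refine ⟨2 * C, fun u h1 h2 => ?_⟩
    have hu1 : 1 ≤ ‖u‖ := h1.trans (Complex.re_le_norm u)
    have h3 : ‖1 - u‖ ≤ 2 * ‖u‖ := by
      refine (norm_sub_le _ _).trans ?_
      rw [norm_one]; linarith
    rw [norm_mul]
    calc ‖u‖ ^ n * (‖1 - u‖ * ‖A u‖) ≤ ‖u‖ ^ n * ((2 * ‖u‖) * ‖A u‖) := by gcongr
      _ = 2 * (‖u‖ ^ (n+1) * ‖A u‖) := by ring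
      _ ≤ 2 * C := by linarith [hC u h1 h2]

lemma Rap.exp {A : ℂ → ℂ} (h : Rap A) (s : ℝ) : Rap (fun u => A u * Complex.exp ((1 - u) * s)) := by
  refine ⟨fun u hu => ?_, fun n b => ?_⟩
  · have : DifferentiableAt ℂ (fun u : ℂ => Complex.exp ((1 - u) * s)) u := by fun_prop
    exact (h.diff u hu).mul this
  · obtain ⟨C, hC⟩ := h.bd n b
    refine ⟨C * Real.exp ((|b| + 1) * |s|), fun u h1 h2 => ?_⟩
    have h3 : ‖Complex.exp ((1 - u) * s)‖ ≤ Real.exp ((|b| + 1) * |s|) := by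
      rw [Complex.norm_exp]
      apply Real.exp_le_exp.mpr
      have : ((1 - u) * s).re = (1 - u.re) * s := by simp
      rw [this]
      refine (le_abs_self _).trans ?_
      rw [abs_mul]
      gcongr
      rw [abs_le]; constructor <;> linarith [le_abs_self b, abs_nonneg b]
    have h4 := hC u h1 h2
    rw [norm_mul, ← mul_assoc]
    have : 0 ≤ ‖u‖ ^ n * ‖A u‖ := by positivity
    gcongr
    linarith

lemma line_re (σ t : ℝ) : ((σ : ℂ) + t * I).re = σ := by simp
lemma line_im (σ t : ℝ) : ((σ : ℂ) + t * I).im = t := by simp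

lemma Rap.line_cont {A : ℂ → ℂ} (h : Rap A) (σ : ℝ) (hσ : 1 ≤ σ) :
    Continuous (fun t : ℝ => A (σ + t * I)) := by
  rw [continuous_iff_continuousAt]
  intro t
  have h1 : ContinuousAt A ((σ : ℂ) + t * I) := (h.diff _ (by rw [line_re]; linarith)).continuousAt
  have h2 : Continuous (fun t : ℝ => (σ : ℂ) + t * I) := by fun_prop
  exact ContinuousAt.comp (f := fun t : ℝ => (σ : ℂ) + t * I) h1 h2.continuousAt

lemma Rap.line_int {A : ℂ → ℂ} (h : Rap A) (σ : ℝ) (hσ : 1 ≤ σ) :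
    Integrable (fun t : ℝ => A (σ + t * I)) := by
  obtain ⟨C, hC⟩ := h.bd 2 σ
  refine (integrable_inv_one_add_sq.const_mul C).mono' (h.line_cont σ hσ).aestronglyMeasurable
    (Eventually.of_forall fun t => ?_)
  have h1 := hC (σ + t * I) (by rw [line_re]; exact hσ) (by rw [line_re])
  have h2 : 1 + t ^ 2 ≤ ‖(σ + t * I : ℂ)‖ ^ 2 := by
    rw [← Complex.normSq_eq_norm_sq, Complex.normSq_apply, line_re, line_im]
    nlinarith
  have h3 : 0 < 1 + t ^ 2 := by positivity
  rw [← div_eq_mul_inv, le_div_iff₀ h3]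
  calc ‖A (σ + t * I)‖ * (1 + t ^ 2) ≤ ‖A (σ + t * I)‖ * ‖(σ + t * I : ℂ)‖ ^ 2 := by gcongr
    _ ≤ C := by rw [mul_comm]; exact h1

lemma Rap.horiz {A : ℂ → ℂ} (h : Rap A) (σ : ℝ) (hσ : 1 ≤ σ) (ε : ℝ) (hε : |ε| = 1) :
    Tendsto (fun T : ℝ => ∫ x in (1:ℝ)..σ, A (x + ((ε * T : ℝ) : ℂ) * I)) atTop (𝓝 0) := by
  obtain ⟨C, hC⟩ := h.bd 1 σ
  have h0 : Tendsto (fun T : ℝ => (C * T⁻¹) * |σ - 1|) atTop (𝓝 0) := by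
    have := (tendsto_inv_atTop_zero.const_mul C).mul_const |σ - 1|
    simpa using this
  refine squeeze_zero_norm' ?_ h0
  filter_upwards [eventually_gt_atTop 0] with T hT
  apply intervalIntegral.norm_integral_le_of_norm_le_const
  intro x hx
  rw [uIoc_of_le hσ] at hx
  have h1 := hC (x + ((ε * T : ℝ) : ℂ) * I) (by rw [line_re]; exact hx.1.le) (by rw [line_re]; exact hx.2)
  have h2 : T ≤ ‖(x + ((ε * T : ℝ) : ℂ) * I)‖ := by
    refine le_trans ?_ (Complex.abs_im_le_norm _)
    rw [line_im, abs_mul, hε, one_mul]; exact le_abs_self T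
  rw [← div_eq_mul_inv, le_div_iff₀ hT]
  calc _ ≤ ‖A (x + ((ε * T : ℝ) : ℂ) * I)‖ * ‖(x + ((ε * T : ℝ) : ℂ) * I)‖ := by gcongr
    _ ≤ C := by rw [mul_comm]; simpa using h1

lemma Rap.contour {A : ℂ → ℂ} (h : Rap A) (σ : ℝ) (hσ : 1 ≤ σ) :
    ∫ t : ℝ, A (1 + t * I) = ∫ t : ℝ, A (σ + t * I) := by
  have hr : ∀ T : ℝ, ((∫ x in (1:ℝ)..σ, A (x + (((-1) * T : ℝ) : ℂ) * I)) -
      ∫ x in (1:ℝ)..σ, A (x + ((1 * T : ℝ) : ℂ) * I)) +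
      I • (∫ y in (-T)..T, A (σ + y * I)) - I • (∫ y in (-T)..T, A ((1:ℝ) + y * I)) = 0 := by
    intro T
    have := Complex.integral_boundary_rect_eq_zero_of_differentiableOn A (⟨1, -T⟩ : ℂ) (⟨σ, T⟩ : ℂ) (by
      intro u hu
      have h1 := hu.1
      simp only [mem_preimage] at h1
      rw [uIcc_of_le hσ] at h1
      exact (h.diff u (by linarith [h1.1])).differentiableWithinAt)
    simpa using this
  have t1 := h.horiz σ hσ (-1) (by simp)
  have t2 := h.horiz σ hσ 1 (by simp)
  have t3 := intervalIntegral_tendsto_integral (h.line_int σ hσ) tendsto_neg_atTop_atBot tendsto_id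
  have t4 := intervalIntegral_tendsto_integral (h.line_int 1 le_rfl) tendsto_neg_atTop_atBot tendsto_id
  have t5 := ((t1.sub t2).add (t3.const_smul I)).sub (t4.const_smul I)
  have t6 := tendsto_nhds_unique t5 (tendsto_const_nhds.congr (fun T => (hr T).symm))
  simp only [sub_zero, zero_add, smul_eq_mul, ← mul_sub] at t6
  have := (mul_eq_zero.mp t6).resolve_left Complex.I_ne_zero
  rw [sub_eq_zero] at this
  rw [this]; simp

noncomputable def Psi (A : ℂ → ℂ) (s : ℝ) : ℂ := ∫ t : ℝ, A (1 + t * I) * Complex.exp (-(t * I) * s)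

lemma Rap.psi_bound {A : ℂ → ℂ} (h : Rap A) (N : ℕ) :
    ∃ C : ℝ, ∀ s : ℝ, ‖Psi A s‖ ≤ C * Real.exp (-N * s) := by
  refine ⟨∫ t : ℝ, ‖A (((1 + N : ℝ) : ℂ) + t * I)‖, fun s => ?_⟩
  have h1 := (h.exp s).contour (1 + N) (by simp)
  have h2 : Psi A s = ∫ t : ℝ, A (1 + t * I) * Complex.exp ((1 - (1 + t * I)) * s) := by
    unfold Psi
    congr 1; ext t; congr 2; ring
  rw [h2, h1]
  refine (norm_integral_le_integral_norm _).trans (le_of_eq ?_)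
  rw [← integral_mul_const]
  congr 1; ext t
  rw [norm_mul, Complex.norm_exp]
  congr 2
  simp

lemma Rap.psi_deriv {A : ℂ → ℂ} (h : Rap A) (s : ℝ) :
    HasDerivAt (Psi A) (Psi (fun u => (1 - u) * A u) s) s := by
  have hc := h.line_cont 1 le_rfl
  have hi := h.line_int 1 le_rfl
  have hi' := h.mul_lin.line_int 1 le_rfl
  have hc' := h.mul_lin.line_cont 1 le_rfl
  simp only [Complex.ofReal_one] at hc hi hi' hc'
  have hn : ∀ t s : ℝ, ‖Complex.exp (-(t * I) * s)‖ = 1 := by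
    intro t s
    rw [Complex.norm_exp]; simp
  have hm : ∀ s : ℝ, Continuous (fun t : ℝ => Complex.exp (-(t * I) * s)) := by
    intro s; fun_prop
  refine (hasDerivAt_integral_of_dominated_loc_of_deriv_le (s := univ)
    (F := fun (s : ℝ) (t : ℝ) => A (1 + t * I) * Complex.exp (-(t * I) * s))
    (F' := fun (s : ℝ) (t : ℝ) => (1 - (1 + t * I)) * A (1 + t * I) * Complex.exp (-(t * I) * s))
    (bound := fun t : ℝ => ‖(1 - (1 + t * I)) * A (1 + t * I)‖)
    univ_mem (Eventually.of_forall fun s => (hc.mul (hm s)).aestronglyMeasurable) ?_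
    (hc'.mul (hm s)).aestronglyMeasurable ?_ hi'.norm ?_).2
  · refine hi.norm.mono' (hc.mul (hm s)).aestronglyMeasurable (Eventually.of_forall fun t => ?_)
    rw [norm_mul, hn, mul_one]
  · refine Eventually.of_forall fun t x _ => ?_
    rw [norm_mul, hn, mul_one]
  · refine Eventually.of_forall fun t x _ => ?_
    have h1 : HasDerivAt (fun x : ℝ => -((t : ℂ) * I) * (x : ℂ)) (-((t : ℂ) * I) * 1) x :=
      (Complex.ofRealCLM.hasDerivAt (x := x)).const_mul _
    have := (h1.cexp).const_mul (A (1 + t * I))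
    refine this.congr_deriv ?_
    ring

lemma Rap.psi_contDiff (n : ℕ) : ∀ {A : ℂ → ℂ}, Rap A → ContDiff ℝ n (Psi A) := by
  induction n with
  | zero =>
    intro A h
    rw [Nat.cast_zero, contDiff_zero]
    exact continuous_iff_continuousAt.mpr fun s => (h.psi_deriv s).continuousAt
  | succ n ih =>
    intro A h
    rw [Nat.cast_succ, contDiff_succ_iff_deriv]
    refine ⟨fun s => (h.psi_deriv s).differentiableAt, by simp, ?_⟩
    have : deriv (Psi A) = Psi (fun u => (1 - u) * A u) := funext fun s => (h.psi_deriv s).deriv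
    rw [this]
    exact ih h.mul_lin

lemma Rap.psi_iter (n : ℕ) : ∀ {A : ℂ → ℂ}, Rap A → ∀ N : ℕ, ∃ C : ℝ, ∀ s : ℝ,
    ‖iteratedDeriv n (Psi A) s‖ ≤ C * Real.exp (-N * s) := by
  induction n with
  | zero =>
    intro A h N
    simpa using h.psi_bound N
  | succ n ih =>
    intro A h N
    have : deriv (Psi A) = Psi (fun u => (1 - u) * A u) := funext fun s => (h.psi_deriv s).deriv
    rw [iteratedDeriv_succ', this]
    exact ih h.mul_lin N

noncomputable def AH (u : ℂ) : ℂ :=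
  (((Real.sqrt Real.pi / (2 * Real.pi) : ℝ) : ℂ) * ((Real.sqrt Real.pi : ℂ) / Real.pi) / DK) *
    ((2 : ℂ) ^ (1 - u) * (Real.pi : ℂ) ^ (-u)) *
    (Complex.Gamma u * Complex.sin (Real.pi * u / 2)) * (Kf u / u)

lemma AH_rap : Rap AH := by
  have hpi : (Real.pi : ℂ) ≠ 0 := by exact_mod_cast Real.pi_ne_zero
  refine ⟨fun u hu => ?_, fun n b => ?_⟩
  · have hu0 : u ≠ 0 := by rintro rfl; simp at hu
    have h1 : DifferentiableAt ℂ (fun u : ℂ => (2 : ℂ) ^ (1 - u)) u :=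
      ((differentiableAt_const _).sub differentiableAt_id).const_cpow (Or.inl (by norm_num))
    have h2 : DifferentiableAt ℂ (fun u : ℂ => (Real.pi : ℂ) ^ (-u)) u :=
      differentiableAt_id.neg.const_cpow (Or.inl hpi)
    have h3 : DifferentiableAt ℂ Complex.Gamma u := Complex.differentiableAt_Gamma u (by
      intro m h
      rw [h] at hu
      simp at hu
      have h0 : (0:ℝ) ≤ m := Nat.cast_nonneg m
      linarith)
    have h4 : DifferentiableAt ℂ (fun u : ℂ => Complex.sin (Real.pi * u / 2)) u := by fun_prop
    have h5 : DifferentiableAt ℂ (fun u : ℂ => Kf u / u) u := (K_diff u).div differentiableAt_id hu0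
    exact (((h1.mul h2).const_mul _).mul (h3.mul h4)).mul h5
  · obtain ⟨C, m, hC⟩ := gamma_sin_bound b
    obtain ⟨C0, hC0⟩ := K_bound 0 1 b
    obtain ⟨C1, hC1⟩ := K_bound (n + m) 1 b
    set c := ‖((Real.sqrt Real.pi / (2 * Real.pi) : ℝ) : ℂ) * ((Real.sqrt Real.pi : ℂ) / Real.pi) / DK‖
    refine ⟨c * |C| * (2 ^ (n + m - 1) * (b ^ (n+m) * C0 + C1)), fun u h1 h2 => ?_⟩
    have hu1 : 1 ≤ ‖u‖ := h1.trans (Complex.re_le_norm u)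
    have hb : 0 ≤ b := by linarith
    have e1 : ‖(2 : ℂ) ^ (1 - u)‖ ≤ 1 := by
      have := Complex.norm_cpow_eq_rpow_re_of_pos (show (0:ℝ) < 2 by norm_num) (1 - u)
      simp only [Complex.ofReal_ofNat] at this
      rw [this]
      apply Real.rpow_le_one_of_one_le_of_nonpos (by norm_num); simp; linarith
    have e2 : ‖(Real.pi : ℂ) ^ (-u)‖ ≤ 1 := by
      rw [Complex.norm_cpow_eq_rpow_re_of_pos Real.pi_pos]
      apply Real.rpow_le_one_of_one_le_of_nonpos (by linarith [Real.pi_gt_three]); simp; linarith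
    have e3 : ‖Complex.Gamma u * Complex.sin (Real.pi * u / 2)‖ ≤ |C| * ‖u‖ ^ m :=
      (hC u h1 h2).trans (by gcongr; exact le_abs_self C)
    have e4 : ‖Kf u / u‖ ≤ ‖Kf u‖ := by
      rw [norm_div]; exact div_le_self (norm_nonneg _) hu1
    have e5 : ‖u‖ ^ (n + m) ≤ 2 ^ (n + m - 1) * (b ^ (n+m) + |u.im| ^ (n+m)) := by
      refine le_trans ?_ (add_pow_le hb (abs_nonneg _) _)
      have := Complex.norm_le_abs_re_add_abs_im u
      rw [abs_of_nonneg (by linarith)] at this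
      gcongr
      linarith
    have k0 := hC0 u h1 h2
    have k1 := hC1 u h1 h2
    simp only [pow_zero, one_mul] at k0
    unfold AH
    rw [norm_mul, norm_mul, norm_mul, norm_mul]
    calc ‖u‖ ^ n * (c * (‖(2 : ℂ) ^ (1 - u)‖ * ‖(Real.pi : ℂ) ^ (-u)‖) *
          ‖Complex.Gamma u * Complex.sin (Real.pi * u / 2)‖ * ‖Kf u / u‖)
        ≤ ‖u‖ ^ n * (c * (1 * 1) * (|C| * ‖u‖ ^ m) * ‖Kf u‖) := by gcongr
      _ = c * |C| * (‖u‖ ^ (n + m) * ‖Kf u‖) := by ring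
      _ ≤ c * |C| * ((2 ^ (n + m - 1) * (b ^ (n+m) + |u.im| ^ (n+m))) * ‖Kf u‖) := by gcongr
      _ = c * |C| * (2 ^ (n + m - 1) * (b ^ (n+m) * ‖Kf u‖ + |u.im| ^ (n+m) * ‖Kf u‖)) := by ring
      _ ≤ _ := by gcongr

lemma H_eq (y : ℝ) (hy : 0 < y) : (y : ℂ) * Hfun y = Psi AH (Real.log y) := by
  have hpi : (Real.pi : ℂ) ≠ 0 := by exact_mod_cast Real.pi_ne_zero
  have hD : (DK : ℂ) ≠ 0 := by exact_mod_cast DK_pos.ne'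
  have hyc : (y : ℂ) ≠ 0 := by exact_mod_cast hy.ne'
  unfold Hfun Psi
  rw [← mul_assoc, ← integral_const_mul]
  congr 1; ext t
  set u : ℂ := 1 + t * I with hu
  have hre : u.re = 1 := by simp [hu]
  have hu0 : u ≠ 0 := by intro h; rw [h] at hre; simp at hre
  have hr := gamma_ratio u hre
  rw [show (2 + (t : ℂ) * I) / 2 = (1 + u) / 2 by rw [hu]; ring,
    show (1 - (t : ℂ) * I) / 2 = (2 - u) / 2 by rw [hu]; ring, hr, Ftilde_eq u (by rw [hre]; norm_num)]
  have e1 : ((Real.pi * y : ℝ) : ℂ) ^ (-u) = (Real.pi : ℂ) ^ (-u) * (y : ℂ) ^ (-u) := by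
    push_cast
    exact Complex.mul_cpow_ofReal_nonneg Real.pi_pos.le hy.le _
  have e2 : (y : ℂ) * (y : ℂ) ^ (-u) = Complex.exp (-(t * I) * (Real.log y : ℝ)) := by
    conv_lhs => rw [← Complex.cpow_one (y : ℂ)]
    rw [Complex.cpow_one (y : ℂ)]
    nth_rewrite 1 [← Complex.cpow_one (y : ℂ)]
    rw [← Complex.cpow_add _ _ hyc, Complex.cpow_def_of_ne_zero hyc, Complex.ofReal_log hy.le]
    congr 1
    rw [hu]; ring
  rw [e1, ← e2]
  unfold AH
  field_simp

structure Good (φ : ℝ → ℂ) : Prop where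
  smooth : ∀ n : ℕ, ContDiff ℝ n φ
  bd : ∀ n N : ℕ, ∃ C : ℝ, ∀ s : ℝ, ‖iteratedDeriv n φ s‖ ≤ C * Real.exp (-N * s)

noncomputable def Wf (n : ℝ) (s : ℝ) : ℂ :=
  ((Real.exp (-Real.exp s - Real.exp (-s) + n * s) : ℝ) : ℂ)

lemma Wf_smooth (n : ℝ) (m : ℕ) : ContDiff ℝ m (Wf n) := by
  have h : ContDiff ℝ m (fun s : ℝ => Real.exp (-Real.exp s - Real.exp (-s) + n * s)) := by fun_prop
  exact Complex.ofRealCLM.contDiff.comp h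

lemma Wf_deriv (n : ℝ) : deriv (Wf n) = fun s => ((n : ℂ) * Wf n s + (-1 : ℂ) * Wf (n + 1) s) + Wf (n - 1) s := by
  ext s
  have h1 : HasDerivAt (fun s : ℝ => -Real.exp s - Real.exp (-s) + n * s)
      (-Real.exp s + Real.exp (-s) + n) s := by
    have a := (Real.hasDerivAt_exp s).neg
    have b := (hasDerivAt_neg s).exp
    have c := (hasDerivAt_id s).const_mul n
    refine ((a.sub b).add c).congr_deriv ?_
    ring
  have h2 := h1.exp.ofReal_comp
  have h3 : deriv (Wf n) s = _ := h2.deriv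
  rw [h3]
  unfold Wf
  rw [show -Real.exp s - Real.exp (-s) + (n + 1) * s = (-Real.exp s - Real.exp (-s) + n * s) + s by ring,
    show -Real.exp s - Real.exp (-s) + (n - 1) * s = (-Real.exp s - Real.exp (-s) + n * s) + -s by ring,
    Real.exp_add _ s, Real.exp_add _ (-s)]
  push_cast
  ring

lemma Wf_eq (n s : ℝ) : Wf n s = ((wK (Real.exp s) * Real.exp (n * s) : ℝ) : ℂ) := by
  unfold Wf wK
  rw [← Real.exp_add, Real.exp_neg]
  simp

lemma Wf_bound (n : ℝ) (N : ℕ) : ∃ C : ℝ, ∀ s : ℝ, ‖Wf n s‖ ≤ C * Real.exp (-N * s) := by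
  obtain ⟨C, hC, h⟩ := wK_le_rpow (-N - n)
  refine ⟨C, fun s => ?_⟩
  rw [Wf_eq, Complex.norm_real, Real.norm_of_nonneg (mul_nonneg (wK_pos _).le (Real.exp_pos _).le)]
  have := h (Real.exp s) (Real.exp_pos s)
  rw [← Real.exp_mul] at this
  calc _ ≤ (C * Real.exp (s * (-N - n))) * Real.exp (n * s) := by gcongr
    _ = _ := by rw [mul_assoc, ← Real.exp_add]; ring_nf

lemma Wf_iter (j : ℕ) : ∀ (n : ℝ) (N : ℕ), ∃ C : ℝ, ∀ s : ℝ,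
    ‖iteratedDeriv j (Wf n) s‖ ≤ C * Real.exp (-N * s) := by
  induction j with
  | zero => intro n N; simpa using Wf_bound n N
  | succ j ih =>
    intro n N
    obtain ⟨C1, h1⟩ := ih n N
    obtain ⟨C2, h2⟩ := ih (n + 1) N
    obtain ⟨C3, h3⟩ := ih (n - 1) N
    refine ⟨|n| * C1 + C2 + C3, fun s => ?_⟩
    rw [iteratedDeriv_succ', Wf_deriv]
    have s1 : ∀ m, ContDiffAt ℝ j (Wf m) s := fun m => (Wf_smooth m j).contDiffAt
    have s2 : ContDiffAt ℝ j (fun s => (n : ℂ) * Wf n s) s := contDiffAt_const.mul (s1 _)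
    have s3 : ContDiffAt ℝ j (fun s => (-1 : ℂ) * Wf (n + 1) s) s := contDiffAt_const.mul (s1 _)
    rw [iteratedDeriv_fun_add (s2.add s3) (s1 _), iteratedDeriv_fun_add s2 s3,
      iteratedDeriv_const_mul_field, iteratedDeriv_const_mul_field]
    have := h1 s
    calc _ ≤ ‖(n : ℂ) * iteratedDeriv j (Wf n) s‖ + ‖(-1 : ℂ) * iteratedDeriv j (Wf (n+1)) s‖
          + ‖iteratedDeriv j (Wf (n-1)) s‖ := norm_add₃_le
      _ = |n| * ‖iteratedDeriv j (Wf n) s‖ + ‖iteratedDeriv j (Wf (n+1)) s‖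
          + ‖iteratedDeriv j (Wf (n-1)) s‖ := by simp
      _ ≤ |n| * (C1 * Real.exp (-N * s)) + C2 * Real.exp (-N * s) + C3 * Real.exp (-N * s) := by
          gcongr
          · exact h2 s
          · exact h3 s
      _ = _ := by ring

noncomputable def PF (s : ℝ) : ℂ := (Fcut (Real.exp s) : ℂ)

lemma PF_hasDeriv (s : ℝ) : HasDerivAt PF ((-(DK : ℂ)⁻¹) * Wf 0 s) s := by
  have hD : (DK : ℂ) ≠ 0 := by exact_mod_cast DK_pos.ne'
  have h1 := (Fcut_deriv (Real.exp_pos s)).comp s (Real.hasDerivAt_exp s)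
  have h2 := h1.ofReal_comp
  refine h2.congr_deriv ?_
  rw [Wf_eq]
  have : vK (Real.exp s) = wK (Real.exp s) / Real.exp s := rfl
  rw [this]
  have he : (Real.exp s : ℂ) ≠ 0 := by exact_mod_cast (Real.exp_pos s).ne'
  push_cast
  simp only [Complex.ofReal_exp] at he ⊢
  simp
  field_simp

lemma PF_deriv : deriv PF = fun s => (-(DK : ℂ)⁻¹) * Wf 0 s := funext fun s => (PF_hasDeriv s).deriv

lemma PF_good : Good PF := by
  constructor
  · intro n
    cases n with
    | zero =>
      rw [Nat.cast_zero, contDiff_zero]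
      exact continuous_iff_continuousAt.mpr fun s => (PF_hasDeriv s).continuousAt
    | succ n =>
      rw [Nat.cast_succ, contDiff_succ_iff_deriv]
      refine ⟨fun s => (PF_hasDeriv s).differentiableAt, by simp, ?_⟩
      rw [PF_deriv]
      exact contDiff_const.mul (Wf_smooth 0 n)
  · intro n N
    cases n with
    | zero =>
      refine ⟨Kr N / DK, fun s => ?_⟩
      have := Fcut_le N (by positivity) (Real.exp_pos s)
      rw [← Real.exp_mul] at this
      simp only [iteratedDeriv_zero]
      unfold PF
      rw [Complex.norm_real, Real.norm_of_nonneg (Fcut_nonneg (Real.exp_pos s))]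
      rwa [mul_comm (-(N:ℝ)) s]
    | succ n =>
      obtain ⟨C, hC⟩ := Wf_iter n 0 N
      refine ⟨‖(-(DK : ℂ)⁻¹)‖ * C, fun s => ?_⟩
      rw [iteratedDeriv_succ', PF_deriv, iteratedDeriv_const_mul_field, norm_mul, mul_assoc]
      gcongr
      exact hC s

noncomputable def Phi (s : ℝ) : ℂ := PF s + Psi AH s

lemma Phi_good : Good Phi := by
  have hs : ∀ n : ℕ, ContDiff ℝ n (Psi AH) := fun n => Rap.psi_contDiff n AH_rap
  refine ⟨fun n => (PF_good.smooth n).add (hs n), fun n N => ?_⟩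
  obtain ⟨C1, h1⟩ := PF_good.bd n N
  obtain ⟨C2, h2⟩ := Rap.psi_iter n AH_rap N
  refine ⟨C1 + C2, fun s => ?_⟩
  unfold Phi
  rw [iteratedDeriv_fun_add (PF_good.smooth n).contDiffAt (hs n).contDiffAt, add_mul]
  exact (norm_add_le _ _).trans (add_le_add (h1 s) (h2 s))

lemma Phi_eq (z : ℝ) (hz : 0 < z) : (Fcut z : ℂ) + (z : ℂ) * Hfun z = Phi (Real.log z) := by
  unfold Phi PF
  rw [H_eq z hz, Real.exp_log hz]


/-- Working open neighbourhood. -/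
def UU : Set ℝ := Ioo (1/8) 2

lemma UU_open : IsOpen UU := isOpen_Ioo
lemma UU_ud : UniqueDiffOn ℝ UU := UU_open.uniqueDiffOn
lemma Icc_UU : Icc (1/4 : ℝ) (5/4) ⊆ UU := by
  intro t ht; constructor <;> linarith [ht.1, ht.2]

structure DB {E : Type} [NormedAddCommGroup E] [NormedSpace ℝ E] (M : ℕ) (f : ℝ → E) (B : ℝ) :
    Prop where
  cd : ContDiffOn ℝ M f UU
  bd : ∀ n ≤ M, ∀ t ∈ Icc (1/4 : ℝ) (5/4), ‖iteratedFDerivWithin ℝ n f UU t‖ ≤ B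

lemma DB.of_contDiffOn {E : Type} [NormedAddCommGroup E] [NormedSpace ℝ E] (M : ℕ) (f : ℝ → E)
    (hf : ContDiffOn ℝ M f UU) : ∃ K : ℝ, 1 ≤ K ∧ DB M f K := by
  have h : ∀ n : ℕ, ∃ K : ℝ, n ≤ M → ∀ t ∈ Icc (1/4 : ℝ) (5/4),
      ‖iteratedFDerivWithin ℝ n f UU t‖ ≤ K := by
    intro n
    by_cases hn : n ≤ M
    · have hc := (hf.continuousOn_iteratedFDerivWithin (m := n) (by exact_mod_cast hn) UU_ud).mono
        Icc_UU
      obtain ⟨K, hK⟩ := isCompact_Icc.exists_bound_of_continuousOn hc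
      exact ⟨K, fun _ => hK⟩
    · exact ⟨0, fun h => absurd h hn⟩
  choose K hK using h
  refine ⟨1 + ∑ n ∈ Finset.range (M+1), |K n|, ?_, hf, fun n hn t ht => ?_⟩
  · have : 0 ≤ ∑ n ∈ Finset.range (M+1), |K n| := Finset.sum_nonneg fun _ _ => abs_nonneg _
    linarith
  · have h1 := hK n hn t ht
    have h2 : |K n| ≤ ∑ n ∈ Finset.range (M+1), |K n| :=
      Finset.single_le_sum (f := fun n => |K n|) (fun _ _ => abs_nonneg _)
        (Finset.mem_range.2 (by omega))
    linarith [le_abs_self (K n)]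

lemma DB.mul {M : ℕ} {f g : ℝ → ℂ} {A B : ℝ} (hf : DB M f A) (hg : DB M g B) (hA : 0 ≤ A) :
    DB M (fun t => f t * g t) (2 ^ M * A * B) := by
  refine ⟨hf.cd.mul hg.cd, fun n hn t ht => ?_⟩
  have hB : 0 ≤ B := (norm_nonneg _).trans (hg.bd 0 (by omega) t ht)
  refine (norm_iteratedFDerivWithin_mul_le hf.cd hg.cd UU_ud (Icc_UU ht)
    (by exact_mod_cast hn)).trans ?_
  calc _ ≤ ∑ i ∈ Finset.range (n+1), (n.choose i : ℝ) * A * B := by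
        refine Finset.sum_le_sum fun i hi => ?_
        have hi' := Finset.mem_range.1 hi
        have h1 := hf.bd i (by omega) t ht
        have h2 := hg.bd (n - i) (by omega) t ht
        gcongr
    _ = 2 ^ n * A * B := by
        rw [← Finset.sum_mul, ← Finset.sum_mul]
        congr 2
        exact_mod_cast Nat.sum_range_choose n
    _ ≤ 2 ^ M * A * B := by
        gcongr
        norm_num

lemma DB.comp {M : ℕ} {g : ℝ → ℂ} {f : ℝ → ℝ} {K C : ℝ} (hf : DB M f K) (hK : 1 ≤ K)
    (hg : ContDiff ℝ M g)
    (hC : ∀ n ≤ M, ∀ t ∈ Icc (1/4 : ℝ) (5/4), ‖iteratedDeriv n g (f t)‖ ≤ C) :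
    DB M (fun t => g (f t)) (M.factorial * C * K ^ M) := by
  refine ⟨hg.comp_contDiffOn hf.cd, fun n hn t ht => ?_⟩
  have hC0 : 0 ≤ C := (norm_nonneg _).trans (hC 0 (by omega) t ht)
  have := norm_iteratedFDerivWithin_comp_le (n := n) (x := t) (s := UU) (t := univ)
    (C := C) (D := K)
    hg.contDiffOn hf.cd (by exact_mod_cast hn) uniqueDiffOn_univ UU_ud (mapsTo_univ _ _)
    (Icc_UU ht)
    (fun i hi => by
      rw [iteratedFDerivWithin_univ, norm_iteratedFDeriv_eq_norm_iteratedDeriv]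
      exact hC i (by omega) t ht)
    (fun i h1 hi => (hf.bd i (by omega) t ht).trans (le_self_pow₀ hK (by omega)))
  refine le_trans this ?_
  gcongr

lemma iter_exp (c : ℂ) (n : ℕ) (s : ℝ) :
    iteratedDeriv n (fun s : ℝ => Complex.exp (c * s)) s = c ^ n * Complex.exp (c * s) := by
  induction n generalizing s with
  | zero => simp
  | succ n ih =>
    rw [iteratedDeriv_succ, funext ih]
    have h : HasDerivAt (fun s : ℝ => Complex.exp (c * s)) (Complex.exp (c * s) * (c * 1)) s := by
      have h1 : HasDerivAt (fun s : ℝ => c * (s : ℂ)) (c * 1) s :=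
        (Complex.ofRealCLM.hasDerivAt (x := s)).const_mul c
      exact h1.cexp
    rw [(h.const_mul (c ^ n)).deriv]
    ring

lemma sqrt_cd (M : ℕ) : ContDiffOn ℝ M (fun t : ℝ => Real.sqrt t) UU := by
  intro t ht
  have : t ≠ 0 := by have := ht.1; linarith
  exact (Real.contDiffAt_sqrt this).contDiffWithinAt

lemma log_cd (M : ℕ) : ContDiffOn ℝ M (fun t : ℝ => -(1/2) * Real.log t) UU := by
  intro t ht
  have : t ≠ 0 := by have := ht.1; linarith
  exact (contDiffAt_const.mul (Real.contDiffAt_log.2 this)).contDiffWithinAt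

noncomputable def hh (α β : ℝ) (t : ℝ) : ℂ :=
  ((Real.sqrt t : ℝ) : ℂ) * Phi (α + (-(1/2) * Real.log t)) *
    Complex.exp (I * β * (Real.sqrt t : ℝ))

lemma hh_bound (M N : ℕ) : ∃ C : ℝ, 0 ≤ C ∧ ∀ α β : ℝ,
    DB M (hh α β) (C * Real.exp (-N * α) * (1 + |β|) ^ M) := by
  obtain ⟨K1, hK1, d1⟩ := DB.of_contDiffOn M _ (sqrt_cd M)
  obtain ⟨K2, hK2, d2⟩ := DB.of_contDiffOn M _ (log_cd M)
  have hs : ContDiffOn ℝ M (fun t : ℝ => ((Real.sqrt t : ℝ) : ℂ)) UU :=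
    Complex.ofRealCLM.contDiff.comp_contDiffOn (sqrt_cd M)
  obtain ⟨K3, hK3, d3⟩ := DB.of_contDiffOn M _ hs
  choose c hc using fun n => Phi_good.bd n N
  set Q : ℝ := (∑ n ∈ Finset.range (M+1), |c n|) * Real.exp N
  have hQ : 0 ≤ Q := mul_nonneg (Finset.sum_nonneg fun _ _ => abs_nonneg _) (Real.exp_pos _).le
  refine ⟨2 ^ M * (2 ^ M * K3 * (M.factorial * Q * K2 ^ M)) * (M.factorial * K1 ^ M), by positivity,
    fun α β => ?_⟩
  have e1 : DB M (fun t => Phi (α + (-(1/2) * Real.log t)))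
      (M.factorial * (Q * Real.exp (-N * α)) * K2 ^ M) := by
    refine DB.comp (g := fun s => Phi (α + s)) d2 hK2
      ((Phi_good.smooth M).comp (contDiff_const.add contDiff_id)) (fun n hn t ht => ?_)
    rw [iteratedDeriv_comp_const_add]
    refine (hc n _).trans ?_
    have hcn : c n ≤ ∑ n ∈ Finset.range (M+1), |c n| := (le_abs_self _).trans
      (Finset.single_le_sum (f := fun n => |c n|) (fun _ _ => abs_nonneg _)
        (Finset.mem_range.2 (by omega)))
    have hlog : Real.log t ≤ 2 := by
      have := Real.log_le_sub_one_of_pos (show 0 < t by linarith [ht.1])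
      linarith [ht.2]
    calc _ ≤ (∑ n ∈ Finset.range (M+1), |c n|) *
          Real.exp (-N * (α + (-(1/2) * Real.log t))) := by gcongr
      _ ≤ (∑ n ∈ Finset.range (M+1), |c n|) * Real.exp (N + (-N * α)) := by
        gcongr
        have : (0:ℝ) ≤ N := by positivity
        nlinarith
      _ = Q * Real.exp (-N * α) := by rw [Real.exp_add]; simp only [Q]; ring
  have e2 : DB M (fun t => Complex.exp (I * β * (Real.sqrt t : ℝ)))
      (M.factorial * (1 + |β|) ^ M * K1 ^ M) := by
    refine DB.comp (g := fun s : ℝ => Complex.exp (I * β * s)) d1 hK1 ?_ (fun n hn t ht => ?_)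
    · exact (contDiff_const.mul Complex.ofRealCLM.contDiff).cexp
    · rw [iter_exp, norm_mul, norm_pow]
      have h1 : ‖Complex.exp (I * β * (Real.sqrt t : ℝ))‖ = 1 := by
        rw [mul_assoc, ← Complex.ofReal_mul, mul_comm, Complex.norm_exp_ofReal_mul_I]
      rw [h1, mul_one, norm_mul, Complex.norm_I, one_mul, Complex.norm_real, Real.norm_eq_abs]
      calc |β| ^ n ≤ (1 + |β|) ^ n := by gcongr; linarith
        _ ≤ (1 + |β|) ^ M := pow_le_pow_right₀ (by linarith [abs_nonneg β]) hn
  have := (d3.mul e1 (by linarith)).mul e2 (by positivity)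
  convert this using 1
  · rfl
  · ring

lemma zero_out {G : ℝ → ℂ} (hs : Function.support G ⊆ Icc (1/4 : ℝ) (5/4)) {t : ℝ}
    (ht : t ∉ Icc (1/4 : ℝ) (5/4)) : G =ᶠ[𝓝 t] fun _ => 0 := by
  filter_upwards [isClosed_Icc.isOpen_compl.mem_nhds ht] with u hu
  by_contra h
  exact hu (hs h)

lemma iter_zero_out {G : ℝ → ℂ} (hs : Function.support G ⊆ Icc (1/4 : ℝ) (5/4)) {t : ℝ}
    (ht : t ∉ Icc (1/4 : ℝ) (5/4)) (n : ℕ) : iteratedDeriv n G t = 0 := by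
  rw [(zero_out hs ht).iteratedDeriv_eq]
  simp [iteratedDeriv_const]

lemma integrable_iter {G : ℝ → ℂ} (hs : Function.support G ⊆ Icc (1/4 : ℝ) (5/4)) {M n : ℕ}
    (hG : ContDiff ℝ M G) (hn : n ≤ M) : Integrable (iteratedDeriv n G) := by
  refine (hG.continuous_iteratedDeriv n (by exact_mod_cast hn)).integrable_of_hasCompactSupport ?_
  exact HasCompactSupport.intro isCompact_Icc fun t ht => iter_zero_out hs ht n

lemma fourier_bd {M : ℕ} {G h : ℝ → ℂ} {B : ℝ} (hG : ContDiff ℝ M G)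
    (hs : Function.support G ⊆ Icc (1/4 : ℝ) (5/4)) (hh : DB M h B) (hB : 0 ≤ B) (c : ℝ) :
    (2 * Real.pi * |c|) ^ M * ‖∫ t, e2 (-(c * t)) * (G t * h t)‖ ≤
      2 ^ M * B * sobolevNorm M G := by
  set f : ℝ → ℂ := fun t => G t * h t with hf
  have hfs : Function.support f ⊆ Icc (1/4 : ℝ) (5/4) := by
    intro t ht
    apply hs
    intro h0
    apply ht
    simp [f, h0]
  have hfc : ContDiff ℝ M f := by
    rw [contDiff_iff_contDiffAt]
    intro t
    by_cases ht : t ∈ Icc (1/4 : ℝ) (5/4)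
    · exact hG.contDiffAt.mul (hh.cd.contDiffAt (UU_open.mem_nhds (Icc_UU ht)))
    · exact contDiffAt_const.congr_of_eventuallyEq (zero_out hfs ht)
  have hpt : ∀ t, ‖iteratedDeriv M f t‖ ≤
      2 ^ M * B * ∑ j ∈ Finset.range (M+1), ‖iteratedDeriv j G t‖ := by
    intro t
    by_cases ht : t ∈ Icc (1/4 : ℝ) (5/4)
    · rw [← norm_iteratedFDeriv_eq_norm_iteratedDeriv,
        ← iteratedFDerivWithin_of_isOpen M UU_open (Icc_UU ht)]
      refine (norm_iteratedFDerivWithin_mul_le hG.contDiffOn hh.cd UU_ud (Icc_UU ht)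
        le_rfl).trans ?_
      rw [Finset.mul_sum]
      refine Finset.sum_le_sum fun i hi => ?_
      have h2 := hh.bd (M - i) (by omega) t ht
      rw [iteratedFDerivWithin_of_isOpen i UU_open (Icc_UU ht),
        norm_iteratedFDeriv_eq_norm_iteratedDeriv]
      have h3 : (M.choose i : ℝ) ≤ 2 ^ M := by exact_mod_cast Nat.choose_le_two_pow M i
      calc _ ≤ 2 ^ M * ‖iteratedDeriv i G t‖ * B := by gcongr
        _ = _ := by ring
    · rw [iter_zero_out hfs ht]
      simp only [norm_zero]
      positivity
  have hint : ∀ j ∈ Finset.range (M+1), Integrable (fun t => ‖iteratedDeriv j G t‖) :=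
    fun j hj => (integrable_iter hs hG (by have := Finset.mem_range.1 hj; omega)).norm
  have hI : ∫ t, ‖iteratedDeriv M f t‖ ≤ 2 ^ M * B * sobolevNorm M G := by
    unfold sobolevNorm
    rw [← integral_finsetSum _ hint, ← integral_const_mul]
    exact integral_mono (integrable_iter hfs hfc le_rfl).norm
      ((integrable_finsetSum _ hint).const_mul _) hpt
  have hF := congrFun (Real.fourier_iteratedDeriv (N := (M : ℕ∞)) (n := M) (f := f)
    (by exact_mod_cast hfc)
    (fun n hn => integrable_iter hfs hfc (by exact_mod_cast hn)) le_rfl) c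
  have hF2 : FourierTransform.fourier f c = ∫ t, e2 (-(c * t)) * (G t * h t) := by
    rw [Real.fourier_real_eq_integral_exp_smul]
    refine integral_congr_ae (Eventually.of_forall fun t => ?_)
    simp only [smul_eq_mul, f]
    unfold e2
    congr 2
    push_cast
    ring
  have hF3 := congrArg norm hF
  rw [norm_smul, hF2, norm_pow] at hF3
  have hn : ‖(2 * Real.pi * I * c : ℂ)‖ = 2 * Real.pi * |c| := by
    simp [abs_of_pos Real.pi_pos]
  rw [hn] at hF3
  rw [← hF3]
  refine le_trans ?_ hI
  rw [Real.fourier_real_eq_integral_exp_smul]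
  refine (norm_integral_le_integral_norm _).trans (le_of_eq ?_)
  congr 1
  funext t
  rw [norm_smul, Complex.norm_exp_ofReal_mul_I, one_mul]

lemma e2_norm (t : ℝ) : ‖e2 t‖ = 1 := by
  unfold e2
  have : (2 * Real.pi * I * t : ℂ) = ((2 * Real.pi * t : ℝ) : ℂ) * I := by push_cast; ring
  rw [this, Complex.norm_exp_ofReal_mul_I]

lemma e2_cont : Continuous e2 := by
  unfold e2
  fun_prop

lemma e2_add (s t : ℝ) : e2 (s + t) = e2 s * e2 t := by
  unfold e2
  rw [← Complex.exp_add]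
  congr 1
  push_cast
  ring

lemma hh_bound0 : ∃ C : ℝ, 0 ≤ C ∧ ∀ α β : ℝ, ∀ t ∈ Icc (1/4 : ℝ) (5/4), ‖hh α β t‖ ≤ C := by
  obtain ⟨C, hC, h⟩ := hh_bound 0 0
  refine ⟨C, hC, fun α β t ht => ?_⟩
  have := (h α β).bd 0 le_rfl t ht
  simpa using this

lemma prod_integrable {G θ : ℝ → ℂ} {α β : ℝ → ℝ} (c : ℝ) (hG : Continuous G)
    (hs : Function.support G ⊆ Icc (1/4 : ℝ) (5/4))
    (hθ : ContinuousOn θ (Ioo (-1) 1)) (hα : ContinuousOn α (Ioo (-1) 1))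
    (hβ : ContinuousOn β (Ioo (-1) 1)) (hθ1 : ∀ x ∈ Ioo (-1 : ℝ) 1, ‖θ x‖ ≤ 1) :
    Integrable (Function.uncurry fun (t x : ℝ) =>
      θ x * (e2 (-(c * t)) * (G t * hh (α x) (β x) t)))
      ((volume.restrict (Ioi (0:ℝ))).prod (volume.restrict (Ioo (-1 : ℝ) 1))) := by
  obtain ⟨C, hC, hb⟩ := hh_bound0
  have hGi : Integrable G := hG.integrable_of_hasCompactSupport
    (HasCompactSupport.intro isCompact_Icc fun t ht => by
      by_contra h
      exact ht (hs h))
  have hmaj : Integrable (fun z : ℝ × ℝ => (C * ‖G z.1‖) * (1 : ℝ))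
      ((volume.restrict (Ioi (0:ℝ))).prod (volume.restrict (Ioo (-1 : ℝ) 1))) :=
    Integrable.mul_prod (f := fun t => C * ‖G t‖) (g := fun _ => (1:ℝ))
      (hGi.norm.const_mul C).integrableOn (by
        have : IsFiniteMeasure (volume.restrict (Ioo (-1 : ℝ) 1)) := inferInstance
        exact integrable_const _)
  have hms : MeasurableSet ((Ioi (0:ℝ)) ×ˢ (Ioo (-1 : ℝ) 1)) :=
    measurableSet_Ioi.prod measurableSet_Ioo
  refine hmaj.mono' ?_ ?_
  · rw [Measure.prod_restrict]
    refine ContinuousOn.aestronglyMeasurable ?_ hms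
    have h1 : MapsTo (Prod.fst : ℝ × ℝ → ℝ) ((Ioi (0:ℝ)) ×ˢ (Ioo (-1 : ℝ) 1)) (Ioi 0) :=
      fun z hz => hz.1
    have h2 : MapsTo (Prod.snd : ℝ × ℝ → ℝ) ((Ioi (0:ℝ)) ×ˢ (Ioo (-1 : ℝ) 1)) (Ioo (-1) 1) :=
      fun z hz => hz.2
    have a1 := hθ.comp continuousOn_snd h2
    have a2 := hα.comp continuousOn_snd h2
    have a3 := hβ.comp continuousOn_snd h2
    have alog : ContinuousOn (fun z : ℝ × ℝ => Real.log z.1)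
        ((Ioi (0:ℝ)) ×ˢ (Ioo (-1 : ℝ) 1)) :=
      continuousOn_fst.log fun z hz => ne_of_gt hz.1
    have asq : ContinuousOn (fun z : ℝ × ℝ => ((Real.sqrt z.1 : ℝ) : ℂ))
        ((Ioi (0:ℝ)) ×ˢ (Ioo (-1 : ℝ) 1)) := by fun_prop
    have aPhi : ContinuousOn (fun z : ℝ × ℝ => Phi (α z.2 + (-(1/2) * Real.log z.1)))
        ((Ioi (0:ℝ)) ×ˢ (Ioo (-1 : ℝ) 1)) :=
      (Phi_good.smooth 0).continuous.comp_continuousOn (a2.add (continuousOn_const.mul alog))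
    have aE : ContinuousOn (fun z : ℝ × ℝ => Complex.exp (I * (β z.2 : ℝ) * (Real.sqrt z.1 : ℝ)))
        ((Ioi (0:ℝ)) ×ˢ (Ioo (-1 : ℝ) 1)) :=
      ((continuousOn_const.mul (Complex.continuous_ofReal.comp_continuousOn a3)).mul asq).cexp
    have ae2 : ContinuousOn (fun z : ℝ × ℝ => e2 (-(c * z.1)))
        ((Ioi (0:ℝ)) ×ˢ (Ioo (-1 : ℝ) 1)) :=
      (e2_cont.comp (by fun_prop : Continuous fun z : ℝ × ℝ => -(c * z.1))).continuousOn
    have aG : ContinuousOn (fun z : ℝ × ℝ => G z.1) ((Ioi (0:ℝ)) ×ˢ (Ioo (-1 : ℝ) 1)) :=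
      (hG.comp continuous_fst).continuousOn
    exact a1.mul (ae2.mul (aG.mul ((asq.mul aPhi).mul aE)))
  · rw [Measure.prod_restrict]
    filter_upwards [ae_restrict_mem hms] with z hz
    simp only [Function.uncurry, norm_mul, e2_norm, one_mul, mul_one]
    by_cases ht : z.1 ∈ Icc (1/4 : ℝ) (5/4)
    · have h1 := hθ1 z.2 hz.2
      have h2 := hb (α z.2) (β z.2) z.1 ht
      calc _ ≤ 1 * (‖G z.1‖ * C) := by gcongr
        _ = _ := by ring
    · have : G z.1 = 0 := by
        by_contra h
        exact ht (hs h)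
      simp [this]

lemma swap_bound (M N : ℕ) : ∃ C : ℝ, 0 ≤ C ∧ ∀ (G θ : ℝ → ℂ) (α β : ℝ → ℝ) (c a0 b : ℝ),
    ContDiff ℝ M G → Function.support G ⊆ Icc (1/4 : ℝ) (5/4) →
    ContinuousOn θ (Ioo (-1) 1) → ContinuousOn α (Ioo (-1) 1) →
    ContinuousOn β (Ioo (-1) 1) → (∀ x ∈ Ioo (-1 : ℝ) 1, ‖θ x‖ ≤ 1) →
    (∀ x ∈ Ioo (-1 : ℝ) 1, a0 ≤ α x) → (∀ x ∈ Ioo (-1 : ℝ) 1, |β x| ≤ b) → c ≠ 0 →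
    ‖∫ t in Ioi (0:ℝ), ∫ x in Ioo (-1 : ℝ) 1, θ x * (e2 (-(c * t)) * (G t * hh (α x) (β x) t))‖ ≤
      (C * Real.exp (-N * a0) * (1 + b) ^ M * sobolevNorm M G) / (2 * Real.pi * |c|) ^ M := by
  obtain ⟨C, hC, hd⟩ := hh_bound M N
  refine ⟨2 ^ (M + 1) * C, by positivity, ?_⟩
  intro G θ α β c a0 b hG hs hθ hα hβ hθ1 ha hb hc
  have hpi := Real.pi_pos
  have hcp : 0 < 2 * Real.pi * |c| := by positivity
  have hS : 0 ≤ sobolevNorm M G :=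
    Finset.sum_nonneg fun j _ => integral_nonneg fun t => norm_nonneg _
  rw [integral_integral_swap (prod_integrable c hG.continuous hs hθ hα hβ hθ1)]
  have key : ∀ x ∈ Ioo (-1 : ℝ) 1,
      ‖∫ t in Ioi (0:ℝ), θ x * (e2 (-(c * t)) * (G t * hh (α x) (β x) t))‖ ≤
      (2 ^ M * (C * Real.exp (-N * a0) * (1 + b) ^ M) * sobolevNorm M G) /
        (2 * Real.pi * |c|) ^ M := by
    intro x hx
    rw [integral_const_mul, norm_mul,
      setIntegral_eq_integral_of_forall_compl_eq_zero (fun t ht => by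
        have : G t = 0 := by
          by_contra h
          have := (hs h).1
          exact ht (show (0:ℝ) < t by linarith)
        simp [this])]
    have h1 := fourier_bd hG hs (hd (α x) (β x)) (by positivity) c
    have hb0 : 0 ≤ b := (abs_nonneg _).trans (hb x hx)
    rw [le_div_iff₀ (by positivity)]
    calc _ ≤ 1 * ‖∫ t, e2 (-(c * t)) * (G t * hh (α x) (β x) t)‖ * (2 * Real.pi * |c|) ^ M := by
          gcongr
          exact hθ1 x hx
      _ = (2 * Real.pi * |c|) ^ M * ‖∫ t, e2 (-(c * t)) * (G t * hh (α x) (β x) t)‖ := by ring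
      _ ≤ _ := h1
      _ ≤ _ := by
          gcongr 2 ^ M * (C * Real.exp ?_ * (1 + ?_) ^ M) * _
          · have : (0:ℝ) ≤ N := by positivity
            nlinarith [ha x hx]
          · exact hb x hx
  have := norm_setIntegral_le_of_norm_le_const (μ := volume) (s := Ioo (-1:ℝ) 1)
    measure_Ioo_lt_top key
  refine this.trans (le_of_eq ?_)
  rw [Real.volume_real_Ioo_of_le (by norm_num)]
  rw [pow_succ]
  ring

lemma theta_cont (k : ℕ) : ContinuousOn (thetaInf k) (Ioo (-1) 1) := by
  have : ContinuousOn (fun x : ℝ => (Complex.I / (2 * (Real.pi : ℂ))) *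
      (((x : ℂ) + Complex.I * (Real.sqrt (1 - x ^ 2) : ℝ)) ^ (k - 1) -
        ((x : ℂ) - Complex.I * (Real.sqrt (1 - x ^ 2) : ℝ)) ^ (k - 1))) (Ioo (-1) 1) := by
    fun_prop
  refine this.congr fun x hx => ?_
  unfold thetaInf
  rw [if_pos (abs_lt.2 hx)]

lemma theta_norm (k : ℕ) (x : ℝ) (hx : x ∈ Ioo (-1 : ℝ) 1) : ‖thetaInf k x‖ ≤ 1 := by
  unfold thetaInf
  rw [if_pos (abs_lt.2 hx)]
  have h1 : 0 ≤ 1 - x ^ 2 := by nlinarith [hx.1, hx.2]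
  have e1 : ‖(x : ℂ) + Complex.I * (Real.sqrt (1 - x ^ 2) : ℝ)‖ = 1 := by
    rw [mul_comm, Complex.norm_add_mul_I, Real.sq_sqrt h1]
    simp
  have e2 : ‖(x : ℂ) - Complex.I * (Real.sqrt (1 - x ^ 2) : ℝ)‖ = 1 := by
    have : (x : ℂ) - Complex.I * (Real.sqrt (1 - x ^ 2) : ℝ) =
      (x : ℂ) + ((-Real.sqrt (1 - x ^ 2) : ℝ) : ℂ) * Complex.I := by push_cast; ring
    rw [this, Complex.norm_add_mul_I, neg_sq, Real.sq_sqrt h1]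
    simp
  have h3 : ‖((x : ℂ) + Complex.I * (Real.sqrt (1 - x ^ 2) : ℝ)) ^ (k - 1) -
        ((x : ℂ) - Complex.I * (Real.sqrt (1 - x ^ 2) : ℝ)) ^ (k - 1)‖ ≤ 2 := by
    refine (norm_sub_le _ _).trans ?_
    rw [norm_pow, norm_pow, e1, e2]
    norm_num
  have h4 : ‖(Complex.I / (2 * (Real.pi : ℂ)))‖ ≤ 1 / 2 := by
    rw [norm_div, norm_mul, Complex.norm_I, Complex.norm_real, Real.norm_eq_abs,
      abs_of_pos Real.pi_pos]
    simp only [Complex.norm_ofNat]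
    apply one_div_le_one_div_of_le (by norm_num)
    nlinarith [Real.pi_gt_three]
  rw [norm_mul]
  calc _ ≤ (1/2 : ℝ) * 2 := by gcongr
    _ = 1 := by norm_num

noncomputable def al (L X x : ℝ) : ℝ := Real.log (L / (2 * Real.sqrt X * Real.sqrt (1 - x ^ 2)))
noncomputable def be (L X : ℝ) (ξ : ℤ) (x : ℝ) : ℝ := -(Real.pi * x * ξ * Real.sqrt X / L)

lemma integrand_eq (k l f : ℕ) (hl : 0 < l) (hf : 0 < f) (ξ ν : ℤ) {X : ℝ} (hX : 0 < X)
    (G : ℝ → ℂ) {t x : ℝ} (ht : 0 < t) (hx : x ∈ Ioo (-1 : ℝ) 1) :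
    ((Real.sqrt (X * t) : ℝ) : ℂ) * G (X * t / X) * thetaInf k x *
      (((Fcut ((l * f ^ 2 : ℝ) / (2 * Real.sqrt (X * t) * Real.sqrt (1 - x ^ 2))) : ℝ) : ℂ) +
        (((l * f ^ 2 : ℝ) / (2 * Real.sqrt (X * t) * Real.sqrt (1 - x ^ 2)) : ℝ) : ℂ) *
          Hfun ((l * f ^ 2 : ℝ) / (2 * Real.sqrt (X * t) * Real.sqrt (1 - x ^ 2)))) *
      e2 (-(2 * x * (ξ : ℝ) * Real.sqrt (X * t) + (X * t) * (ν : ℝ)) / (4 * (l : ℝ) * (f : ℝ) ^ 2))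
    = ((Real.sqrt X : ℝ) : ℂ) * (thetaInf k x * (e2 (-((X * ν / (4 * (l * f ^ 2 : ℝ))) * t)) *
        (G t * hh (al (l * f ^ 2 : ℝ) X x) (be (l * f ^ 2 : ℝ) X ξ x) t))) := by
  have hL : (0:ℝ) < l * f ^ 2 := by positivity
  have hl' : (l : ℝ) ≠ 0 := by positivity
  have hf' : (f : ℝ) ≠ 0 := by positivity
  have hw : 0 < Real.sqrt (1 - x ^ 2) := Real.sqrt_pos.2 (by nlinarith [hx.1, hx.2])
  have hsX : 0 < Real.sqrt X := Real.sqrt_pos.2 hX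
  have hst : 0 < Real.sqrt t := Real.sqrt_pos.2 ht
  have hsq : Real.sqrt (X * t) = Real.sqrt X * Real.sqrt t := Real.sqrt_mul hX.le t
  rw [Phi_eq _ (by rw [hsq]; positivity), mul_div_cancel_left₀ t hX.ne', hsq]
  have hlog : Real.log ((l * f ^ 2 : ℝ) /
      (2 * (Real.sqrt X * Real.sqrt t) * Real.sqrt (1 - x ^ 2))) =
      al (l * f ^ 2 : ℝ) X x + (-(1/2) * Real.log t) := by
    unfold al
    have : (l * f ^ 2 : ℝ) / (2 * (Real.sqrt X * Real.sqrt t) * Real.sqrt (1 - x ^ 2)) =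
      ((l * f ^ 2 : ℝ) / (2 * Real.sqrt X * Real.sqrt (1 - x ^ 2))) / Real.sqrt t := by
      field_simp
    rw [this, Real.log_div (by positivity) hst.ne', Real.log_sqrt ht.le]
    ring
  have he : e2 (-(2 * x * (ξ : ℝ) * (Real.sqrt X * Real.sqrt t) + (X * t) * (ν : ℝ)) /
      (4 * (l : ℝ) * (f : ℝ) ^ 2)) = e2 (-((X * ν / (4 * (l * f ^ 2 : ℝ))) * t)) *
      Complex.exp (I * (be (l * f ^ 2 : ℝ) X ξ x : ℝ) * (Real.sqrt t : ℝ)) := by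
    have h1 : -(2 * x * (ξ : ℝ) * (Real.sqrt X * Real.sqrt t) + (X * t) * (ν : ℝ)) /
      (4 * (l : ℝ) * (f : ℝ) ^ 2) = -((X * ν / (4 * (l * f ^ 2 : ℝ))) * t) +
        (-(x * ξ * Real.sqrt X * Real.sqrt t / (2 * (l * f ^ 2 : ℝ)))) := by
      field_simp
      ring
    rw [h1, e2_add]
    congr 1
    unfold e2 be
    congr 1
    push_cast
    have hl2 : (l : ℂ) ≠ 0 := by exact_mod_cast hl.ne'
    have hf2 : (f : ℂ) ≠ 0 := by exact_mod_cast hf.ne'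
    field_simp
  rw [hlog, he]
  unfold hh
  push_cast
  ring

lemma J_eq (k l f : ℕ) (hl : 0 < l) (hf : 0 < f) (ξ ν : ℤ) {X : ℝ} (hX : 0 < X) (G : ℝ → ℂ) :
    Jlf k l f ξ ν X G = (X : ℂ) * (((Real.sqrt X : ℝ) : ℂ) *
      ∫ t in Ioi (0:ℝ), ∫ x in Ioo (-1 : ℝ) 1, thetaInf k x *
        (e2 (-((X * ν / (4 * (l * f ^ 2 : ℝ))) * t)) *
        (G t * hh (al (l * f ^ 2 : ℝ) X x) (be (l * f ^ 2 : ℝ) X ξ x) t))) := by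
  unfold Jlf
  have h := integral_comp_mul_left_Ioi (fun y : ℝ => ∫ x in (-1 : ℝ)..1,
    ((Real.sqrt y : ℝ) : ℂ) * G (y / X) * thetaInf k x *
      (((Fcut ((l * f ^ 2 : ℝ) / (2 * Real.sqrt y * Real.sqrt (1 - x ^ 2))) : ℝ) : ℂ) +
        (((l * f ^ 2 : ℝ) / (2 * Real.sqrt y * Real.sqrt (1 - x ^ 2)) : ℝ) : ℂ) *
          Hfun ((l * f ^ 2 : ℝ) / (2 * Real.sqrt y * Real.sqrt (1 - x ^ 2)))) *
      e2 (-(2 * x * (ξ : ℝ) * Real.sqrt y + y * (ν : ℝ)) / (4 * (l : ℝ) * (f : ℝ) ^ 2))) 0 hX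
  rw [mul_zero] at h
  have h2 := congrArg (fun z : ℂ => (X : ℂ) * z) h
  simp only [Complex.real_smul] at h2
  rw [← mul_assoc, ← Complex.ofReal_mul, mul_inv_cancel₀ hX.ne', Complex.ofReal_one, one_mul] at h2
  rw [← h2]
  congr 1
  rw [← integral_const_mul]
  refine setIntegral_congr_fun measurableSet_Ioi fun t ht => ?_
  rw [intervalIntegral.integral_of_le (by norm_num), integral_Ioc_eq_integral_Ioo,
    ← integral_const_mul]
  refine setIntegral_congr_fun measurableSet_Ioo fun x hx => ?_
  exact integrand_eq k l f hl hf ξ ν hX G ht hx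

lemma al_cont {L X : ℝ} (hL : 0 < L) (hX : 0 < X) : ContinuousOn (al L X) (Ioo (-1) 1) := by
  have hsX : 0 < Real.sqrt X := Real.sqrt_pos.2 hX
  unfold al
  refine ContinuousOn.log (ContinuousOn.div continuousOn_const (by fun_prop) ?_) ?_
  all_goals
    intro x hx
    have hw : 0 < Real.sqrt (1 - x ^ 2) := Real.sqrt_pos.2 (by nlinarith [hx.1, hx.2])
    positivity

lemma al_ge {L X : ℝ} (hL : 0 < L) (hX : 0 < X) (x : ℝ) (hx : x ∈ Ioo (-1 : ℝ) 1) :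
    Real.log (L / (2 * Real.sqrt X)) ≤ al L X x := by
  have hsX : 0 < Real.sqrt X := Real.sqrt_pos.2 hX
  have hw : 0 < Real.sqrt (1 - x ^ 2) := Real.sqrt_pos.2 (by nlinarith [hx.1, hx.2])
  have hw1 : Real.sqrt (1 - x ^ 2) ≤ 1 := Real.sqrt_le_one.2 (by nlinarith [sq_nonneg x])
  unfold al
  apply Real.log_le_log (by positivity)
  apply div_le_div_of_nonneg_left hL.le (by positivity)
  nlinarith

lemma be_le {L X : ℝ} (hL : 0 < L) (ξ : ℤ) (x : ℝ) (hx : x ∈ Ioo (-1 : ℝ) 1) :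
    |be L X ξ x| ≤ Real.pi * |(ξ : ℝ)| * Real.sqrt X / L := by
  unfold be
  have hpi := Real.pi_pos
  rw [abs_neg, abs_div, abs_mul, abs_mul, abs_mul, abs_of_pos hpi, abs_of_pos hL,
    abs_of_nonneg (Real.sqrt_nonneg X)]
  have : |x| ≤ 1 := (abs_lt.2 hx).le
  gcongr
  nlinarith

lemma final_alg (M N : ℕ) {C S L r ν b : ℝ} (hC : 0 ≤ C) (hS : 0 ≤ S) (hL : 0 < L) (hr : 0 < r)
    (hν : 0 < ν) (hb : 0 ≤ b) :
    r ^ 2 * (r * ((C * ((2 * r) / L) ^ N * (1 + Real.pi * b * r / L) ^ M * S) /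
      (2 * Real.pi * (r ^ 2 * ν / (4 * L))) ^ M)) ≤
    2 ^ (2 * M + N) * C * S * ((r ^ N / r ^ M * r ^ 3) / (ν ^ M * L ^ N)) *
      ((L / r) ^ M + b ^ M) := by
  have hpi := Real.pi_pos
  have h1 : (1 + Real.pi * b * r / L) ^ M ≤ 2 ^ M * (1 + (Real.pi * b * r / L) ^ M) := by
    have := add_pow_le (zero_le_one) (show 0 ≤ Real.pi * b * r / L by positivity) M
    rw [one_pow] at this
    refine this.trans ?_
    gcongr
    · norm_num
    · omega
  have h2 : (L / (Real.pi * r)) ^ M * (1 + (Real.pi * b * r / L) ^ M) ≤ (L / r) ^ M + b ^ M := by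
    rw [mul_add, mul_one, ← mul_pow]
    have e : L / (Real.pi * r) * (Real.pi * b * r / L) = b := by field_simp
    rw [e]
    gcongr
    nlinarith [Real.pi_gt_three]
  calc _ ≤ r ^ 2 * (r * ((C * ((2 * r) / L) ^ N * (2 ^ M * (1 + (Real.pi * b * r / L) ^ M)) * S) /
      (2 * Real.pi * (r ^ 2 * ν / (4 * L))) ^ M)) := by gcongr
    _ = 2 ^ (2 * M + N) * C * S * ((r ^ N / r ^ M * r ^ 3) / (ν ^ M * L ^ N)) *
      ((L / (Real.pi * r)) ^ M * (1 + (Real.pi * b * r / L) ^ M)) := by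
        have e : 2 * Real.pi * (r ^ 2 * ν / (4 * L)) = Real.pi * r * r * ν / (2 * L) := by
          field_simp; ring
        rw [e]
        generalize (1 + (Real.pi * b * r / L) ^ M) = Y
        simp only [div_pow, mul_pow, pow_add, pow_mul]
        have : ((2:ℝ)^2)^M = 2^M * 2^M := by rw [← mul_pow]; norm_num
        rw [this]
        field_simp
    _ ≤ _ := by gcongr

lemma rpow_eq (M N : ℕ) {X : ℝ} (hX : 0 < X) : X ^ (((N : ℝ) - (M : ℝ) + 3) / 2) =
    Real.sqrt X ^ N / Real.sqrt X ^ M * Real.sqrt X ^ 3 := by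
  have hs : 0 < Real.sqrt X := Real.sqrt_pos.2 hX
  have h : X ^ (((N : ℝ) - (M : ℝ) + 3) / 2) = Real.sqrt X ^ ((N : ℝ) - (M : ℝ) + 3) := by
    rw [Real.sqrt_eq_rpow, ← Real.rpow_mul hX.le]
    congr 1
    ring
  rw [h, Real.rpow_add hs, Real.rpow_sub hs, Real.rpow_natCast, Real.rpow_natCast]
  congr 1
  exact_mod_cast Real.rpow_natCast (Real.sqrt X) 3

theorem main_bound (k : ℕ) (M N : ℕ) :
    ∃ C : ℝ, ∀ G : ℝ → ℂ, ContDiff ℝ (⊤ : ℕ∞) G →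
      Function.support G ⊆ Set.Icc (1/4 : ℝ) (5/4) →
      ∀ X : ℝ, 1 ≤ X → ∀ l f : ℕ, 0 < l → 0 < f → ∀ ξ ν : ℤ, ν ≠ 0 →
        ‖Jlf k l f ξ ν X G‖ ≤
          C * sobolevNorm M G *
            (X ^ (((N : ℝ) - (M : ℝ) + 3) / 2) /
              (|(ν : ℝ)| ^ M * (l * f ^ 2 : ℝ) ^ N)) *
            (((l * f ^ 2 : ℝ) / Real.sqrt X) ^ M + |(ξ : ℝ)| ^ M) := by
  obtain ⟨C, hC, hsw⟩ := swap_bound M N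
  refine ⟨2 ^ (2 * M + N) * C, ?_⟩
  intro G hG hs X hX1 l f hl hf ξ ν hν
  have hX : 0 < X := by linarith
  have hL : (0:ℝ) < l * f ^ 2 := by positivity
  have hr : 0 < Real.sqrt X := Real.sqrt_pos.2 hX
  have hν' : 0 < |(ν : ℝ)| := abs_pos.2 (by exact_mod_cast hν)
  have hν0 : (ν : ℝ) ≠ 0 := by exact_mod_cast hν
  have hS : 0 ≤ sobolevNorm M G :=
    Finset.sum_nonneg fun j _ => integral_nonneg fun t => norm_nonneg _
  rw [J_eq k l f hl hf ξ ν hX G, norm_mul, norm_mul, Complex.norm_real, Complex.norm_real,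
    Real.norm_of_nonneg hX.le, Real.norm_of_nonneg hr.le, rpow_eq M N hX]
  generalize (l * f ^ 2 : ℝ) = L at hL ⊢
  have hGM : ContDiff ℝ M G := hG.of_le (by exact_mod_cast le_top)
  have hb := hsw G (thetaInf k) (al L X) (be L X ξ) (X * ν / (4 * L))
    (Real.log (L / (2 * Real.sqrt X))) (Real.pi * |(ξ : ℝ)| * Real.sqrt X / L) hGM hs
    (theta_cont k) (al_cont hL hX) (by unfold be; fun_prop) (theta_norm k)
    (al_ge hL hX) (be_le hL ξ) (by positivity)
  have hexp : Real.exp (-N * Real.log (L / (2 * Real.sqrt X))) = (2 * Real.sqrt X / L) ^ N := by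
    rw [neg_mul, ← mul_neg, ← Real.log_inv, inv_div, Real.exp_nat_mul,
      Real.exp_log (by positivity)]
  have hc : |X * ν / (4 * L)| = Real.sqrt X ^ 2 * |(ν : ℝ)| / (4 * L) := by
    rw [abs_div, abs_mul, abs_of_pos hX, abs_of_pos (show 0 < 4 * L by positivity),
      Real.sq_sqrt hX.le]
  rw [hexp, hc] at hb
  refine le_trans ?_ (final_alg M N hC hS hL hr hν' (abs_nonneg (ξ : ℝ)))
  rw [Real.sq_sqrt hX.le] at hb ⊢
  gcongr

end JB

/-- For `k ≥ 3` and all `M, N ∈ ℕ` there is a constant `C` (depending only on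
`k`, `M`, `N`) such that for every smooth `G` supported in `[1/4, 5/4]`, every
`X ≥ 1`, all positive `l, f`, every `ξ ∈ ℤ` and every nonzero `ν ∈ ℤ`:
`|J_{l,f}(ξ, ν, X)| ≤ C·‖G‖_{M,1}·(X^{(N−M+3)/2}/(|ν|^M (lf²)^N))·[(lf²/√X)^M + |ξ|^M]`. -/
theorem Jlf_bound_nu_ne_zero (k : ℕ) (hk : 3 ≤ k) (M N : ℕ) :
    ∃ C : ℝ, ∀ G : ℝ → ℂ, ContDiff ℝ (⊤ : ℕ∞) G →
      Function.support G ⊆ Set.Icc (1/4 : ℝ) (5/4) →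
      ∀ X : ℝ, 1 ≤ X → ∀ l f : ℕ, 0 < l → 0 < f → ∀ ξ ν : ℤ, ν ≠ 0 →
        ‖Jlf k l f ξ ν X G‖ ≤
          C * sobolevNorm M G *
            (X ^ (((N : ℝ) - (M : ℝ) + 3) / 2) /
              (|(ν : ℝ)| ^ M * (l * f ^ 2 : ℝ) ^ N)) *
            (((l * f ^ 2 : ℝ) / Real.sqrt X) ^ M + |(ξ : ℝ)| ^ M) := by
  exact JB.main_bound k M N
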